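/- Let k, m ∈ ℕ and let α ∈ (k−1, k) be a non-integer real with α + m > 1/2. There exists a constant C > 0, depending only on α and m, such that for every integer p with α + m < p + 1 and every ω ∈ 𝒰^{α,m}_{−1+}((−1,1)), the Gauss–Radau projection Π_p^− ω satisfies ‖ω − Π_p^− ω‖_{L²(−1,1)} ≤ C · p^{−min{2α+1, α+m−1/2}} · U^{α,m}_{−1+}(ω;(−1,1)). -/

import Mathlib

open MeasureTheory Set Filter

/-- The left Caputo fractional derivative of order `α ∈ (k−1,k)` based at `a`:
`(^C D^α_{a+} u)(x) = (1/Γ(k−α)) ∫_a^x (x−y)^{k−α−1} u^{(k)}(y) dy`. -/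
noncomputable def caputoL (k : ℕ) (α a : ℝ) (u : ℝ → ℝ) (x : ℝ) : ℝ :=
  (1 / Real.Gamma ((k : ℝ) - α)) *
    ∫ y in a..x, (x - y) ^ ((k : ℝ) - α - 1) * iteratedDeriv k u y

/-- Membership `ω ∈ 𝒰^{α,m}_{−1+}((−1,1))`: `ω ∈ W^{k,1}(−1,1)` and
`^C D^α_{−1+} ω ∈ W^{m,1}(−1,1)`, with `L i` the (finite) right-hand limits
`D^i(^C D^α_{−1+} ω)(−1+)` for `i < m`. -/
def MemUL (k m : ℕ) (α : ℝ) (ω : ℝ → ℝ) (L : ℕ → ℝ) : Prop :=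
  ContinuousOn ω (Icc (-1 : ℝ) 1) ∧
  (∀ i < k, ∀ x ∈ Ioo (-1 : ℝ) 1,
      HasDerivAt (iteratedDeriv i ω) (iteratedDeriv (i + 1) ω x) x) ∧
  (∀ i ≤ k, IntervalIntegrable (iteratedDeriv i ω) volume (-1) 1) ∧
  (∀ i < m, ∀ x ∈ Ioo (-1 : ℝ) 1,
      HasDerivAt (iteratedDeriv i (caputoL k α (-1) ω))
        (iteratedDeriv (i + 1) (caputoL k α (-1) ω) x) x) ∧
  (∀ i ≤ m, IntervalIntegrable (iteratedDeriv i (caputoL k α (-1) ω)) volume (-1) 1) ∧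
  (∀ i < m, Tendsto (iteratedDeriv i (caputoL k α (-1) ω))
      (nhdsWithin (-1 : ℝ) (Ioi (-1))) (nhds (L i)))

/-- The semi-norm `U^{α,m}_{−1+}(ω;(−1,1))`. -/
noncomputable def UsemiL (k m : ℕ) (α : ℝ) (ω : ℝ → ℝ) (L : ℕ → ℝ) : ℝ :=
  (∫ x in (-1 : ℝ)..1, |iteratedDeriv m (caputoL k α (-1) ω) x|) +
    ∑ i ∈ Finset.range m, |L i|

namespace RadauCaputo

open Polynomial

/-- The Legendre polynomials, normalised by the value `1` at `1`, through the first-order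
recurrence `(n+1) P_{n+1} = (n+1) x P_n - (1-x²) P_n'`. -/
noncomputable def legendre : ℕ → ℝ[X]
  | 0 => 1
  | n + 1 => X * legendre n - C (1 / ((n : ℝ) + 1)) * ((1 - X ^ 2) * derivative (legendre n))

theorem smul_legendre_succ (n : ℕ) :
    (C (n : ℝ) + 1) * legendre (n + 1) =
      (C (n : ℝ) + 1) * (X * legendre n) - (1 - X ^ 2) * derivative (legendre n) := by
  have h : (C (n : ℝ) + 1) * C (1 / ((n : ℝ) + 1)) = (1 : ℝ[X]) := by
    rw [← C_1, ← C_add, ← C_mul, mul_one_div_cancel (by positivity)]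
  rw [legendre, mul_sub, ← mul_assoc _ (C _), h, one_mul]

theorem C_natCast_add_one_ne_zero (n : ℕ) : (C (n : ℝ) + 1 : ℝ[X]) ≠ 0 := by
  rw [← C_1, ← C_add, Ne, C_eq_zero]; positivity

theorem derivative_legendre_succ_of_ode {n : ℕ}
    (h : (1 - X ^ 2) * derivative (derivative (legendre n)) - 2 * X * derivative (legendre n) =
      - (C (n : ℝ) * (C (n : ℝ) + 1) * legendre n)) :
    derivative (legendre (n + 1)) =
      X * derivative (legendre n) + (C (n : ℝ) + 1) * legendre n := by
  have h1 := congrArg derivative (smul_legendre_succ n)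
  apply mul_left_cancel₀ (C_natCast_add_one_ne_zero n)
  simp only [derivative_mul, derivative_C, derivative_X, derivative_sub, derivative_one,
    derivative_add, derivative_X_sq, C_ofNat] at h1
  linear_combination h1 - h

theorem legendre_ode (n : ℕ) :
    (1 - X ^ 2) * derivative (derivative (legendre n)) - 2 * X * derivative (legendre n) =
      - (C (n : ℝ) * (C (n : ℝ) + 1) * legendre n) := by
  induction n with
  | zero => simp [legendre]
  | succ n ih =>
    have h2 := derivative_legendre_succ_of_ode ih
    have h3 := congrArg derivative h2
    simp only [derivative_mul, derivative_C, derivative_X, derivative_add, derivative_one] at h3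
    have h0 := smul_legendre_succ n
    have h1 := congrArg derivative h0
    simp only [derivative_mul, derivative_C, derivative_X, derivative_sub, derivative_one,
      derivative_add, derivative_X_sq, C_ofNat] at h1
    rw [h3]
    simp only [Nat.cast_add, Nat.cast_one, C_add, C_1]
    linear_combination (-2 * X) * h2 + (C (n : ℝ) + 2) * h0 + X * ih

/-- `P_{n+1}' = x P_n' + (n+1) P_n`. -/
theorem derivative_legendre_succ (n : ℕ) :
    derivative (legendre (n + 1)) =
      X * derivative (legendre n) + (C (n : ℝ) + 1) * legendre n :=
  derivative_legendre_succ_of_ode (legendre_ode n)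

/-- `x P_{n+1}' = P_n' + (n+1) P_{n+1}`. -/
theorem X_mul_derivative_legendre_succ (n : ℕ) :
    X * derivative (legendre (n + 1)) =
      derivative (legendre n) + (C (n : ℝ) + 1) * legendre (n + 1) := by
  linear_combination X * derivative_legendre_succ n - smul_legendre_succ n

/-- `P_{n+2}' - P_n' = (2n+3) P_{n+1}`. -/
theorem derivative_legendre_add_two_sub (n : ℕ) :
    derivative (legendre (n + 2)) - derivative (legendre n) =
      C (2 * (n : ℝ) + 3) * legendre (n + 1) := by
  have h1 := derivative_legendre_succ (n + 1)
  have h2 := X_mul_derivative_legendre_succ n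
  simp only [Nat.cast_add, Nat.cast_one, C_add, C_1, C_mul, C_ofNat] at h1 ⊢
  linear_combination h1 + h2

theorem eval_one_legendre (n : ℕ) : (legendre n).eval 1 = 1 := by
  induction n with
  | zero => simp [legendre]
  | succ n ih => simp [legendre, ih]

theorem eval_neg_one_legendre (n : ℕ) : (legendre n).eval (-1) = (-1) ^ n := by
  induction n with
  | zero => simp [legendre]
  | succ n ih => simp [legendre, ih, pow_succ]

theorem natDegree_legendre_le (n : ℕ) : (legendre n).natDegree ≤ n := by
  induction n with
  | zero => simp [legendre]
  | succ n ih =>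
    rw [legendre]
    rcases Nat.eq_zero_or_pos n with rfl | hn
    · simp [legendre]
    refine (natDegree_sub_le _ _).trans (max_le ?_ ?_)
    · exact (natDegree_mul_le).trans (by rw [natDegree_X]; omega)
    · refine (natDegree_C_mul_le _ _).trans (natDegree_mul_le.trans ?_)
      have h1 : (1 - X ^ 2 : ℝ[X]).natDegree ≤ 2 := by compute_degree
      have h2 := natDegree_derivative_le (legendre n)
      omega

theorem integral_derivative_eval (f : ℝ[X]) (a b : ℝ) :
    ∫ x in a..b, (derivative f).eval x = f.eval b - f.eval a :=
  intervalIntegral.integral_eq_sub_of_hasDerivAt (fun x _ => f.hasDerivAt x)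
    ((derivative f).continuous.intervalIntegrable _ _)

/-- The Sonin function of `(1-x²) P_n'` bounds this polynomial by the mass of `P_n`. -/
theorem sq_one_sub_sq_mul_derivative_legendre (n : ℕ) (x : ℝ) :
    ((1 - x ^ 2) * (derivative (legendre n)).eval x) ^ 2 +
        (1 - x ^ 2) * (n * (n + 1)) * (legendre n).eval x ^ 2 =
      ∫ t in x..1, 2 * t * (n * (n + 1)) * (legendre n).eval t ^ 2 := by
  set S : ℝ[X] := ((1 - X ^ 2) * derivative (legendre n)) ^ 2 +
    (1 - X ^ 2) * (C (n : ℝ) * (C (n : ℝ) + 1)) * legendre n ^ 2 with hS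
  have hd : derivative S = -(2 * X * (C (n : ℝ) * (C (n : ℝ) + 1)) * legendre n ^ 2) := by
    simp only [hS, derivative_mul, derivative_C, derivative_sub, derivative_one,
      derivative_add, derivative_X, C_ofNat, derivative_sq]
    linear_combination (2 * (1 - X ^ 2) * derivative (legendre n)) * legendre_ode n
  have h := integral_derivative_eval S x 1
  simp only [hd] at h
  simp only [hS, eval_add, eval_mul, eval_pow, eval_sub, eval_one, eval_X, eval_C, eval_neg,
    eval_ofNat, intervalIntegral.integral_neg] at h
  simp only [one_pow, sub_self, zero_mul, ne_eq, OfNat.ofNat_ne_zero, not_false_eq_true, zero_pow,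
    add_zero, zero_sub, neg_inj] at h
  rw [h]

theorem abs_eval_legendre_le_one (n : ℕ) {x : ℝ} (hx : x ∈ Icc (-1 : ℝ) 1) :
    |(legendre n).eval x| ≤ 1 := by
  rcases Nat.eq_zero_or_pos n with rfl | hn
  · simp [legendre]
  have hN : (0 : ℝ) < n * (n + 1) := by positivity
  set S : ℝ[X] := C (n : ℝ) * (C (n : ℝ) + 1) * legendre n ^ 2 +
    (1 - X ^ 2) * derivative (legendre n) ^ 2 with hS
  have hd : derivative S = 2 * X * derivative (legendre n) ^ 2 := by
    simp only [hS, derivative_mul, derivative_C, derivative_sub, derivative_one,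
      derivative_add, derivative_X, C_ofNat, derivative_sq]
    linear_combination (2 * derivative (legendre n)) * legendre_ode n
  have hval : ∀ y, S.eval y = n * (n + 1) * (legendre n).eval y ^ 2 +
      (1 - y ^ 2) * (derivative (legendre n)).eval y ^ 2 := by
    intro y; simp [hS]
  have hder : ∀ y, (derivative S).eval y = 2 * y * (derivative (legendre n)).eval y ^ 2 := by
    intro y; simp [hd]
  have key : S.eval x ≤ n * (n + 1) := by
    rcases le_total 0 x with h | h
    · have h1 := integral_derivative_eval S x 1
      have h2 : 0 ≤ ∫ t in x..1, (derivative S).eval t := by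
        refine intervalIntegral.integral_nonneg hx.2 fun t ht => ?_
        rw [hder]
        have := h.trans ht.1
        positivity
      rw [hval 1, eval_one_legendre] at h1
      linarith
    · have h1 := integral_derivative_eval S (-1) x
      have h2 : 0 ≤ ∫ t in (-1)..x, -(derivative S).eval t := by
        refine intervalIntegral.integral_nonneg hx.1 fun t ht => ?_
        rw [hder]
        have : 0 ≤ -t := by linarith [ht.2]
        have := mul_nonneg this (sq_nonneg ((derivative (legendre n)).eval t))
        linarith
      rw [intervalIntegral.integral_neg] at h2
      rw [hval (-1), eval_neg_one_legendre, ← pow_mul, mul_comm n 2, pow_mul] at h1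
      norm_num at h1
      linarith
  rw [hval] at key
  have h3 : 0 ≤ (1 - x ^ 2) * (derivative (legendre n)).eval x ^ 2 :=
    mul_nonneg (by nlinarith [hx.1, hx.2]) (sq_nonneg _)
  have h4 : (legendre n).eval x ^ 2 ≤ 1 := by
    by_contra! h
    nlinarith
  exact abs_le_one_iff_mul_self_le_one.2 (by nlinarith)

theorem one_add_mul_derivative_legendre_sub (n : ℕ) :
    (1 + X) * (derivative (legendre (n + 1)) - derivative (legendre n)) =
      (C (n : ℝ) + 1) * (legendre (n + 1) + legendre n) := by
  linear_combination derivative_legendre_succ n + X_mul_derivative_legendre_succ n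

theorem intervalIntegrable_one_add_rpow_mul {b : ℝ} (hb : -1 < b) {f : ℝ → ℝ}
    (hf : Continuous f) :
    IntervalIntegrable (fun x => (1 + x) ^ b * f x) volume (-1) 1 := by
  refine IntervalIntegrable.mul_continuousOn ?_ hf.continuousOn
  have h := (intervalIntegral.intervalIntegrable_rpow' (a := 0) (b := 2) hb).comp_add_left (c := 1)
  norm_num at h
  exact h

/-- The endpoint moments `∫ (1+x)^b P_n` satisfy a two-term recurrence in `n`. -/
theorem moment_legendre_succ {b : ℝ} (hb : -1 < b) (n : ℕ) :
    (n + 2 + b) * ∫ x in (-1 : ℝ)..1, (1 + x) ^ b * (legendre (n + 1)).eval x =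
      (b - n) * ∫ x in (-1 : ℝ)..1, (1 + x) ^ b * (legendre n).eval x := by
  have hi := fun n => intervalIntegrable_one_add_rpow_mul hb (legendre n).continuous
  set F : ℝ → ℝ := fun x => (1 + x) ^ (b + 1) * (legendre (n + 1) - legendre n).eval x with hF
  set G : ℝ → ℝ := fun x => (b + 1) * ((1 + x) ^ b * (legendre (n + 1)).eval x) -
      (b + 1) * ((1 + x) ^ b * (legendre n).eval x) +
      ((n + 1) * ((1 + x) ^ b * (legendre (n + 1)).eval x) +
        (n + 1) * ((1 + x) ^ b * (legendre n).eval x)) with hG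
  have hd : ∀ x ∈ Ioo (-1 : ℝ) 1, HasDerivAt F (G x) x := by
    intro x hx
    have hx0 : 0 < 1 + x := by linarith [hx.1]
    have h1 : HasDerivAt (fun x : ℝ => (1 + x) ^ (b + 1)) ((b + 1) * (1 + x) ^ b) x := by
      have := ((hasDerivAt_id x).const_add 1).rpow_const (p := b + 1) (Or.inl hx0.ne')
      simpa using this
    have h2 := h1.mul ((legendre (n + 1) - legendre n).hasDerivAt x)
    refine h2.congr_deriv ?_
    have h3 := congrArg (eval x) (one_add_mul_derivative_legendre_sub n)
    simp only [eval_mul, eval_add, eval_sub, eval_one, eval_X, eval_C] at h3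
    simp only [hG, derivative_sub, eval_sub, Real.rpow_add_one hx0.ne']
    linear_combination ((1 + x) ^ b) * h3
  have hGi : IntervalIntegrable G volume (-1) 1 :=
    (((hi _).const_mul _).sub ((hi _).const_mul _)).add
      (((hi _).const_mul _).add ((hi _).const_mul _))
  have hFc : ContinuousOn F (Icc (-1) 1) := by
    refine Continuous.continuousOn (Continuous.mul ?_ (Polynomial.continuous _))
    exact (continuous_const.add continuous_id).rpow_const fun _ => Or.inr (by linarith)
  have h := intervalIntegral.integral_eq_sub_of_hasDerivAt_of_le (by norm_num) hFc hd hGi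
  have hz : F 1 - F (-1) = 0 := by
    have : (0 : ℝ) ^ (b + 1) = 0 := Real.zero_rpow (by linarith)
    simp [hF, eval_one_legendre, this]
  rw [hz, hG, intervalIntegral.integral_add (((hi _).const_mul _).sub ((hi _).const_mul _))
      (((hi _).const_mul _).add ((hi _).const_mul _)),
    intervalIntegral.integral_sub ((hi _).const_mul _) ((hi _).const_mul _),
    intervalIntegral.integral_add ((hi _).const_mul _) ((hi _).const_mul _)] at h
  simp only [intervalIntegral.integral_const_mul] at h
  linear_combination h

theorem moment_legendre_eq_zero {j n : ℕ} (h : j < n) :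
    ∫ x in (-1 : ℝ)..1, (1 + x) ^ (j : ℝ) * (legendre n).eval x = 0 := by
  have hj : (-1 : ℝ) < j := by linarith [Nat.cast_nonneg (α := ℝ) j]
  induction n, h using Nat.le_induction with
  | base =>
    have h := moment_legendre_succ hj j
    rw [sub_self, zero_mul] at h
    exact (mul_eq_zero.1 h).resolve_left (by positivity)
  | succ n _ ih =>
    have h := moment_legendre_succ hj n
    rw [ih, mul_zero] at h
    exact (mul_eq_zero.1 h).resolve_left (by positivity)

theorem integral_mul_legendre_eq_zero {n : ℕ} {v : ℝ[X]} (hv : v.natDegree < n) :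
    ∫ x in (-1 : ℝ)..1, v.eval x * (legendre n).eval x = 0 := by
  have hd : (v.comp (X - 1)).natDegree < n := by
    rw [natDegree_comp]
    have : (X - 1 : ℝ[X]).natDegree = 1 := by simpa using natDegree_X_sub_C (1 : ℝ)
    simpa [this] using hv
  have h1 : ∀ x, v.eval x * (legendre n).eval x = ∑ i ∈ Finset.range n,
      (v.comp (X - 1)).coeff i * ((1 + x) ^ (i : ℝ) * (legendre n).eval x) := by
    intro x
    have : v.eval x = (v.comp (X - 1)).eval (1 + x) := by simp
    rw [this, eval_eq_sum_range' hd, Finset.sum_mul]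
    simp only [Real.rpow_natCast, mul_assoc]
  simp only [h1]
  rw [intervalIntegral.integral_finsetSum]
  · refine Finset.sum_eq_zero fun i hi => ?_
    rw [intervalIntegral.integral_const_mul, moment_legendre_eq_zero (Finset.mem_range.1 hi),
      mul_zero]
  · intro i _
    have hj : (-1 : ℝ) < i := by linarith [Nat.cast_nonneg (α := ℝ) i]
    exact (intervalIntegrable_one_add_rpow_mul hj (legendre n).continuous).const_mul _

theorem integral_legendre_mul_legendre {i j : ℕ} (h : i ≠ j) :
    ∫ x in (-1 : ℝ)..1, (legendre i).eval x * (legendre j).eval x = 0 := by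
  rcases h.lt_or_gt with h | h
  · exact integral_mul_legendre_eq_zero ((natDegree_legendre_le i).trans_lt h)
  · simp only [mul_comm ((legendre i).eval _)]
    exact integral_mul_legendre_eq_zero ((natDegree_legendre_le j).trans_lt h)

theorem integral_legendre_sq (n : ℕ) :
    ∫ x in (-1 : ℝ)..1, (legendre n).eval x ^ 2 = 2 / (2 * n + 1) := by
  have hodd : (-1 : ℝ) ^ (n + (n + 1)) = -1 := by
    rw [← add_assoc, ← two_mul, pow_succ, pow_mul]; norm_num
  have heven : (-1 : ℝ) ^ (n * 2) = 1 := by rw [mul_comm, pow_mul]; norm_num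
  have h1 := integral_derivative_eval (legendre n * legendre (n + 1)) (-1) 1
  have h2 := integral_derivative_eval (X * legendre n ^ 2) (-1) 1
  simp only [eval_mul, eval_pow, eval_X, eval_one_legendre, eval_neg_one_legendre, ← pow_add,
    ← pow_mul, hodd, heven] at h1 h2
  have h3 : ∫ x in (-1 : ℝ)..1, (derivative (legendre n)).eval x * (legendre (n + 1)).eval x = 0 :=
    integral_mul_legendre_eq_zero
      (by have := natDegree_derivative_le (legendre n); have := natDegree_legendre_le n; omega)
  have e1 : ∀ x, (derivative (legendre n * legendre (n + 1))).eval x -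
      (derivative (legendre n)).eval x * (legendre (n + 1)).eval x =
      (derivative (X * legendre n ^ 2)).eval x / 2 + (n + 1 / 2) * (legendre n).eval x ^ 2 := by
    intro x
    have := congrArg (eval x) (derivative_legendre_succ n)
    simp only [derivative_mul, derivative_sq, derivative_X, eval_add, eval_mul, eval_pow, eval_X,
      eval_one, eval_C] at this ⊢
    linear_combination (legendre n).eval x * this
  have hint : ∀ {f : ℝ → ℝ}, Continuous f → IntervalIntegrable f volume (-1) 1 :=
    fun hf => hf.intervalIntegrable _ _
  have e2 := intervalIntegral.integral_congr (μ := volume) (a := -1) (b := 1)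
    (fun x _ => e1 x)
  rw [intervalIntegral.integral_sub (hint (by fun_prop)) (hint (by fun_prop)),
    intervalIntegral.integral_add (hint (by fun_prop)) (hint (by fun_prop)),
    intervalIntegral.integral_div, intervalIntegral.integral_const_mul, h1, h2, h3] at e2
  field_simp
  linarith

theorem natDegree_legendre (n : ℕ) : (legendre n).natDegree = n := by
  refine (natDegree_legendre_le n).eq_of_not_lt fun h => ?_
  have h1 := integral_mul_legendre_eq_zero h
  simp only [← sq] at h1
  rw [integral_legendre_sq] at h1
  have : (0 : ℝ) < 2 / (2 * n + 1) := by positivity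
  exact this.ne' h1

theorem legendre_ne_zero (n : ℕ) : legendre n ≠ 0 := fun h => by
  simpa [h] using eval_one_legendre n

/-- Every polynomial is a finite linear combination of Legendre polynomials. -/
theorem exists_eq_sum_legendre (q : ℝ[X]) :
    ∃ (s : Finset ℕ) (c : ℕ → ℝ), q = ∑ i ∈ s, c i • legendre i := by
  let S : Polynomial.Sequence ℝ := ⟨legendre, fun i => by
    rw [degree_eq_natDegree (legendre_ne_zero i), natDegree_legendre]⟩
  have h := S.span fun i => (isUnit_iff_ne_zero.2 (leadingCoeff_ne_zero.2 (legendre_ne_zero i)))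
  have hq : q ∈ Submodule.span ℝ (Set.range legendre) := by
    have : Set.range legendre = Set.range S := rfl
    rw [this, h]; trivial
  obtain ⟨c, hc⟩ := Finsupp.mem_span_range_iff_exists_finsupp.1 hq
  exact ⟨c.support, c, hc.symm⟩

theorem abs_one_sub_sq_mul_derivative_legendre_le (n : ℕ) {x : ℝ} (hx : x ∈ Icc (-1 : ℝ) 1) :
    ((1 - x ^ 2) * (derivative (legendre n)).eval x) ^ 2 ≤
      4 * (n * (n + 1)) / (2 * n + 1) := by
  have h0 : 0 ≤ (1 - x ^ 2) * (n * (n + 1)) * (legendre n).eval x ^ 2 :=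
    mul_nonneg (mul_nonneg (by nlinarith [hx.1, hx.2]) (by positivity)) (sq_nonneg _)
  have h1 := sq_one_sub_sq_mul_derivative_legendre n x
  have hc : Continuous fun t => 2 * ((n : ℝ) * (n + 1)) * (legendre n).eval t ^ 2 := by fun_prop
  have hc' : Continuous fun t => 2 * t * ((n : ℝ) * (n + 1)) * (legendre n).eval t ^ 2 := by
    fun_prop
  have h2 : ∫ t in x..1, 2 * t * (n * (n + 1)) * (legendre n).eval t ^ 2 ≤
      ∫ t in x..1, 2 * (n * (n + 1)) * (legendre n).eval t ^ 2 := by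
    refine intervalIntegral.integral_mono_on hx.2 (hc'.intervalIntegrable _ _)
      (hc.intervalIntegrable _ _) fun t ht => ?_
    have : 0 ≤ (n * (n + 1)) * (legendre n).eval t ^ 2 := by positivity
    nlinarith [ht.2]
  have h3 : ∫ t in x..1, 2 * (n * (n + 1)) * (legendre n).eval t ^ 2 ≤
      ∫ t in (-1 : ℝ)..1, 2 * (n * (n + 1)) * (legendre n).eval t ^ 2 :=
    intervalIntegral.integral_mono_interval hx.1 hx.2 le_rfl
      (Eventually.of_forall fun t => by positivity) (hc.intervalIntegrable _ _)
  rw [intervalIntegral.integral_const_mul (a := -1), integral_legendre_sq] at h3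
  have : 2 * ((n : ℝ) * (n + 1)) * (2 / (2 * n + 1)) = 4 * (n * (n + 1)) / (2 * n + 1) := by ring
  linarith

theorem integral_rpow_mul_sub_rpow {s t a : ℝ} (hs : 0 < s) (ht : 0 < t) (ha : 0 < a) :
    ∫ x in (0 : ℝ)..a, x ^ (s - 1) * (a - x) ^ (t - 1) =
      a ^ (s + t - 1) * (Real.Gamma s * Real.Gamma t / Real.Gamma (s + t)) := by
  have h := Complex.betaIntegral_scaled s t ha
  have h1 : ∫ x in (0 : ℝ)..a, (x : ℂ) ^ ((s : ℂ) - 1) * ((a : ℂ) - x) ^ ((t : ℂ) - 1) =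
      ∫ x in (0 : ℝ)..a, ((x ^ (s - 1) * (a - x) ^ (t - 1) : ℝ) : ℂ) := by
    refine intervalIntegral.integral_congr fun x hx => ?_
    rw [uIcc_of_le ha.le] at hx
    simp only [Complex.ofReal_mul]
    rw [Complex.ofReal_cpow hx.1, Complex.ofReal_cpow (sub_nonneg.2 hx.2)]
    push_cast
    rfl
  rw [h1, intervalIntegral.integral_ofReal, Complex.betaIntegral_eq_Gamma_mul_div _ _
    (by simpa using hs) (by simpa using ht)] at h
  have h2 : (a : ℂ) ^ ((s : ℂ) + t - 1) = ((a ^ (s + t - 1) : ℝ) : ℂ) := by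
    rw [Complex.ofReal_cpow ha.le]; push_cast; rfl
  rw [h2, Complex.Gamma_ofReal, Complex.Gamma_ofReal, ← Complex.ofReal_add,
    Complex.Gamma_ofReal] at h
  exact_mod_cast h

theorem integral_sub_rpow_mul_one_sub_rpow {θ r s : ℝ} (hθ : 0 < θ) (hr : -1 < r) (hs : s < 1) :
    ∫ x in s..1, (x - s) ^ (θ - 1) * (1 - x) ^ r =
      (1 - s) ^ (θ + r) * (Real.Gamma θ * Real.Gamma (r + 1) / Real.Gamma (θ + (r + 1))) := by
  have h := integral_rpow_mul_sub_rpow hθ (show 0 < r + 1 by linarith) (sub_pos.2 hs)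
  have h2 := intervalIntegral.integral_comp_sub_right
    (fun x => x ^ (θ - 1) * (1 - s - x) ^ (r + 1 - 1)) s (a := s) (b := 1)
  rw [sub_self] at h2
  rw [← h2] at h
  convert h using 1
  · refine intervalIntegral.integral_congr fun x _ => ?_
    simp
  · ring_nf

theorem intervalIntegrable_sub_rpow_mul_one_sub_rpow {θ r s : ℝ} (hθ : 0 < θ) (hr : -1 < r)
    (hs : s < 1) :
    IntervalIntegrable (fun x => (x - s) ^ (θ - 1) * (1 - x) ^ r) volume s 1 := by
  apply intervalIntegral.intervalIntegrable_of_integral_ne_zero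
  rw [integral_sub_rpow_mul_one_sub_rpow hθ hr hs]
  have h1 := Real.Gamma_pos_of_pos hθ
  have h2 := Real.Gamma_pos_of_pos (show 0 < r + 1 by linarith)
  have h3 := Real.Gamma_pos_of_pos (show 0 < θ + (r + 1) by linarith)
  have h4 := Real.rpow_pos_of_pos (sub_pos.2 hs) (θ + r)
  positivity

/-- The right Riemann–Liouville fractional integral of order `β` based at `1` of a polynomial,
written in powers of `1 - x`; it makes sense for every `β > -1`. -/
noncomputable def fracInt (β x : ℝ) : ℝ[X] →ₗ[ℝ] ℝ :=
  (Polynomial.lsum fun l : ℕ =>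
    (Real.Gamma (l + 1) / Real.Gamma (l + 1 + β) * (1 - x) ^ ((l : ℝ) + β)) •
      (LinearMap.id : ℝ →ₗ[ℝ] ℝ)) ∘ₗ (aeval (1 - X : ℝ[X])).toLinearMap

theorem fracInt_one_sub_X_pow (β x : ℝ) (l : ℕ) :
    fracInt β x ((1 - X) ^ l) =
      Real.Gamma (l + 1) / Real.Gamma (l + 1 + β) * (1 - x) ^ ((l : ℝ) + β) := by
  have : (aeval (1 - X : ℝ[X])) ((1 - X : ℝ[X]) ^ l) = monomial l (1 : ℝ) := by
    simp [X_pow_eq_monomial]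
  simp only [fracInt, LinearMap.comp_apply, AlgHom.toLinearMap_apply, this, lsum_apply]
  rw [sum_monomial_index _ _ (by simp)]
  simp

theorem one_sub_X_pow_induction {motive : ℝ[X] → Prop} (R : ℝ[X])
    (add : ∀ p q, motive p → motive q → motive (p + q))
    (smul : ∀ (a : ℝ) p, motive p → motive (a • p)) (pow : ∀ l : ℕ, motive ((1 - X) ^ l)) :
    motive R := by
  have h : ∀ Q : ℝ[X], motive (aeval (1 - X : ℝ[X]) Q) := by
    intro Q
    induction Q using Polynomial.induction_on' with
    | add p q hp hq => rw [map_add]; exact add _ _ hp hq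
    | monomial n a =>
      rw [aeval_monomial, algebraMap_eq, ← smul_eq_C_mul]
      exact smul _ _ (pow n)
  have := h (aeval (1 - X : ℝ[X]) R)
  rwa [show aeval (1 - X : ℝ[X]) (aeval (1 - X : ℝ[X]) R) = R by
    rw [← comp_eq_aeval, ← comp_eq_aeval, comp_assoc]; simp] at this

theorem fracInt_zero (x : ℝ) (R : ℝ[X]) : fracInt 0 x R = R.eval x := by
  induction R using one_sub_X_pow_induction with
  | add p q hp hq => rw [map_add, hp, hq, eval_add]
  | smul a p hp => rw [map_smul, hp, eval_smul]
  | pow l =>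
    have := (Real.Gamma_pos_of_pos (show (0 : ℝ) < l + 1 by positivity)).ne'
    simp [fracInt_one_sub_X_pow, div_self this]

theorem hasDerivAt_fracInt {β x : ℝ} (hβ : -1 < β) (hx : x < 1) (R : ℝ[X]) :
    HasDerivAt (fun x => fracInt (β + 1) x R) (-fracInt β x R) x := by
  induction R using one_sub_X_pow_induction with
  | add p q hp hq =>
    simp only [map_add, neg_add]
    exact hp.add hq
  | smul a p hp =>
    simp only [map_smul, ← smul_neg]
    exact hp.const_smul a
  | pow l =>
    have hl : (0 : ℝ) < l + 1 + β := by have := Nat.cast_nonneg (α := ℝ) l; linarith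
    have h1 := (((hasDerivAt_id x).const_sub 1).rpow_const (p := (l : ℝ) + (β + 1))
      (Or.inl (sub_pos.2 hx).ne')).const_mul
      (Real.Gamma (l + 1) / Real.Gamma (l + 1 + (β + 1)))
    simp only [fracInt_one_sub_X_pow]
    refine h1.congr_deriv ?_
    rw [show (l : ℝ) + 1 + (β + 1) = (l + 1 + β) + 1 by ring, Real.Gamma_add_one hl.ne',
      show (l : ℝ) + (β + 1) - 1 = l + β by ring]
    have := (Real.Gamma_pos_of_pos hl).ne'
    field_simp
    simp only [id]
    ring

theorem continuous_fracInt {β : ℝ} (hβ : 0 ≤ β) (R : ℝ[X]) :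
    Continuous fun x => fracInt β x R := by
  induction R using one_sub_X_pow_induction with
  | add p q hp hq => simp only [map_add]; exact hp.add hq
  | smul a p hp => simp only [map_smul]; exact hp.const_smul a
  | pow l =>
    simp only [fracInt_one_sub_X_pow]
    exact continuous_const.mul
      ((continuous_const.sub continuous_id).rpow_const fun _ => Or.inr (by positivity))

theorem fracInt_at_one {β : ℝ} (hβ : 0 < β) (R : ℝ[X]) : fracInt β 1 R = 0 := by
  induction R using one_sub_X_pow_induction with
  | add p q hp hq => rw [map_add, hp, hq, add_zero]
  | smul a p hp => rw [map_smul, hp, smul_zero]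
  | pow l =>
    rw [fracInt_one_sub_X_pow, sub_self, Real.zero_rpow (by positivity), mul_zero]

theorem intervalIntegrable_fracInt {β : ℝ} (hβ : -1 < β) (R : ℝ[X]) (a b : ℝ) :
    IntervalIntegrable (fun x => fracInt β x R) volume a b := by
  induction R using one_sub_X_pow_induction with
  | add p q hp hq => simp only [map_add]; exact hp.add hq
  | smul c p hp => simp only [map_smul]; exact hp.const_mul c
  | pow l =>
    simp only [fracInt_one_sub_X_pow]
    have hl : -1 < (l : ℝ) + β := by have := Nat.cast_nonneg (α := ℝ) l; linarith
    have h := (intervalIntegral.intervalIntegrable_rpow' (a := 1 - a) (b := 1 - b) hl).comp_sub_left 1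
    simp only [sub_sub_cancel] at h
    exact h.const_mul _

theorem fracInt_integral {θ β s : ℝ} (hθ : 0 < θ) (hβ : -1 < β) (hs : s < 1) (R : ℝ[X]) :
    IntervalIntegrable (fun x => (x - s) ^ (θ - 1) * fracInt β x R) volume s 1 ∧
      ∫ x in s..1, (x - s) ^ (θ - 1) * fracInt β x R =
        Real.Gamma θ * fracInt (β + θ) s R := by
  induction R using one_sub_X_pow_induction with
  | add p q hp hq =>
    simp only [map_add, mul_add]
    refine ⟨hp.1.add hq.1, ?_⟩
    rw [intervalIntegral.integral_add hp.1 hq.1, hp.2, hq.2]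
  | smul a p hp =>
    simp only [map_smul, smul_eq_mul, mul_left_comm _ a]
    refine ⟨hp.1.const_mul a, ?_⟩
    rw [intervalIntegral.integral_const_mul, hp.2]
  | pow l =>
    simp only [fracInt_one_sub_X_pow, mul_left_comm _ (Real.Gamma _ / Real.Gamma _)]
    have hl : -1 < (l : ℝ) + β := by have := Nat.cast_nonneg (α := ℝ) l; linarith
    refine ⟨(intervalIntegrable_sub_rpow_mul_one_sub_rpow hθ hl hs).const_mul _, ?_⟩
    rw [intervalIntegral.integral_const_mul, integral_sub_rpow_mul_one_sub_rpow hθ hl hs]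
    have h1 := (Real.Gamma_pos_of_pos (show 0 < (l : ℝ) + β + 1 by linarith)).ne'
    have h2 := (Real.Gamma_pos_of_pos (show 0 < θ + ((l : ℝ) + β + 1) by linarith)).ne'
    rw [show (l : ℝ) + 1 + β = l + β + 1 by ring,
      show (l : ℝ) + 1 + (β + θ) = θ + (l + β + 1) by ring,
      show (l : ℝ) + (β + θ) = θ + (l + β) by ring]
    field_simp

theorem fracInt_succ_neg_derivative (β x : ℝ) (Q : ℝ[X]) :
    fracInt (β + 1) x (-derivative Q) = fracInt β x (Q - C (Q.eval 1)) := by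
  induction Q using one_sub_X_pow_induction with
  | add p q hp hq =>
    rw [derivative_add, neg_add, map_add, hp, hq, ← map_add, eval_add, C_add]
    congr 1; ring
  | smul a p hp =>
    rw [derivative_smul, ← smul_neg, map_smul, hp, ← map_smul, eval_smul, smul_sub, smul_C]
  | pow l =>
    rcases l with _ | l
    · simp
    · have h1 : -derivative ((1 - X : ℝ[X]) ^ (l + 1)) = ((l : ℝ) + 1) • (1 - X) ^ l := by
        rw [derivative_pow, smul_eq_C_mul]
        simp
      have hl : (0 : ℝ) < l + 1 := by positivity
      rw [h1, map_smul, fracInt_one_sub_X_pow]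
      simp only [eval_pow, eval_sub, eval_one, eval_X, sub_self, ne_eq, Nat.succ_ne_zero,
        not_false_eq_true, zero_pow, C_0, sub_zero, fracInt_one_sub_X_pow, smul_eq_mul]
      push_cast
      rw [Real.Gamma_add_one hl.ne', show (l : ℝ) + (β + 1) = l + 1 + β by ring,
        show (l : ℝ) + 1 + (β + 1) = l + 1 + 1 + β by ring]
      ring

/-- `J_{β+1} P_{n+1} = (J_β P_n - J_β P_{n+2}) / (2n+3)`. -/
theorem fracInt_succ_legendre (β x : ℝ) (n : ℕ) :
    (2 * n + 3) * fracInt (β + 1) x (legendre (n + 1)) =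
      fracInt β x (legendre n) - fracInt β x (legendre (n + 2)) := by
  have h := fracInt_succ_neg_derivative β x (legendre n - legendre (n + 2))
  rw [derivative_sub, neg_sub, derivative_legendre_add_two_sub, ← smul_eq_C_mul, map_smul,
    eval_sub, eval_one_legendre, eval_one_legendre, sub_self, C_0, sub_zero, map_sub] at h
  exact h

/-- The fractional integrals of order `β` of the Legendre polynomials of degree at least `N`
decay like `n ^ (-s)`, uniformly on `[-1, 1]`. -/
def FracBound (β : ℝ) (N : ℕ) (s : ℝ) : Prop :=
  ∃ K, 0 ≤ K ∧ ∀ n ≥ N, ∀ x ∈ Icc (-1 : ℝ) 1,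
    |fracInt β x (legendre n)| ≤ K * (n : ℝ) ^ (-s)

theorem fracBound_zero : FracBound 0 0 0 :=
  ⟨1, zero_le_one, fun n _ x hx => by
    simpa [fracInt_zero] using abs_eval_legendre_le_one n hx⟩

theorem mul_fracInt_one_legendre (n : ℕ) (x : ℝ) :
    n * (n + 1) * fracInt 1 x (legendre n) = (1 - x ^ 2) * (derivative (legendre n)).eval x := by
  have h := fracInt_succ_neg_derivative 0 x ((1 - X ^ 2) * derivative (legendre n))
  have h1 : -derivative ((1 - X ^ 2) * derivative (legendre n)) =
      ((n : ℝ) * (n + 1)) • legendre n := by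
    simp only [derivative_mul, derivative_sub, derivative_one, derivative_X_sq, C_ofNat,
      smul_eq_C_mul, C_mul, C_add, C_1]
    linear_combination -(legendre_ode n)
  rw [h1, map_smul, zero_add, fracInt_zero] at h
  simpa using h

theorem fracBound_one : FracBound 1 1 (3 / 2) := by
  refine ⟨2, zero_le_two, fun n hn x hx => ?_⟩
  have hn0 : (0 : ℝ) < n := by exact_mod_cast hn
  have h1 := abs_one_sub_sq_mul_derivative_legendre_le n hx
  rw [← mul_fracInt_one_legendre] at h1
  have hpow : ((n : ℝ) ^ (-(3 / 2 : ℝ))) ^ 2 = 1 / (n : ℝ) ^ 3 := by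
    rw [← Real.rpow_natCast, ← Real.rpow_mul hn0.le, ← Real.rpow_natCast, one_div,
      ← Real.rpow_neg hn0.le]
    norm_num
  have hy : (0 : ℝ) ≤ (n : ℝ) ^ (-(3 / 2 : ℝ)) := Real.rpow_nonneg hn0.le _
  refine abs_le_of_sq_le_sq ?_ (by positivity)
  rw [mul_pow, hpow]
  have hN : (0 : ℝ) < n * (n + 1) := by positivity
  have h2 : (fracInt 1 x (legendre n)) ^ 2 ≤ 4 / (n * (n + 1) * (2 * n + 1)) := by
    rw [le_div_iff₀ (by positivity)] at h1 ⊢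
    have h3 : n * (n + 1) * ((fracInt 1 x (legendre n)) ^ 2 * (n * (n + 1) * (2 * n + 1))) ≤
        n * (n + 1) * 4 := by linarith
    exact le_of_mul_le_mul_left h3 hN
  refine h2.trans ?_
  rw [show (2 : ℝ) ^ 2 * (1 / (n : ℝ) ^ 3) = 4 / (n : ℝ) ^ 3 by ring]
  gcongr
  nlinarith [sq_nonneg (n : ℝ)]

theorem rpow_neg_le_two_rpow_mul {s : ℝ} (hs : 0 ≤ s) (k : ℕ) :
    (k : ℝ) ^ (-s) ≤ 2 ^ s * ((k : ℝ) + 1) ^ (-s) := by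
  rcases Nat.eq_zero_or_pos k with rfl | hk
  · simpa using (Real.zero_rpow_le_one _).trans (Real.one_le_rpow one_le_two hs)
  have hk0 : (1 : ℝ) ≤ k := by exact_mod_cast hk
  calc (k : ℝ) ^ (-s) = 2 ^ s * (2 * k) ^ (-s) := by
        rw [Real.mul_rpow zero_le_two (by positivity), ← mul_assoc, ← Real.rpow_add two_pos]
        simp
    _ ≤ 2 ^ s * ((k : ℝ) + 1) ^ (-s) := by
        refine mul_le_mul_of_nonneg_left ?_ (by positivity)
        exact Real.rpow_le_rpow_of_nonpos (by positivity) (by linarith) (by linarith)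

theorem FracBound.succ {β s : ℝ} {N : ℕ} (hs : 0 ≤ s) (h : FracBound β N s) :
    FracBound (β + 1) (N + 1) (s + 1) := by
  obtain ⟨K, hK, h⟩ := h
  refine ⟨K * 2 ^ s * 2, by positivity, fun n hn x hx => ?_⟩
  obtain ⟨k, rfl⟩ : ∃ k, n = k + 1 := ⟨n - 1, by omega⟩
  have h0 := h k (by omega) x hx
  have h2 := h (k + 2) (by omega) x hx
  have hrec := fracInt_succ_legendre β x k
  have e0 := rpow_neg_le_two_rpow_mul hs k
  have e2 : ((k + 2 : ℕ) : ℝ) ^ (-s) ≤ 2 ^ s * ((k : ℝ) + 1) ^ (-s) := by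
    have a1 : ((k + 2 : ℕ) : ℝ) ^ (-s) ≤ ((k : ℝ) + 1) ^ (-s) := by
      refine Real.rpow_le_rpow_of_nonpos (by positivity) ?_ (by linarith)
      push_cast; linarith
    have a2 : (0 : ℝ) ≤ ((k : ℝ) + 1) ^ (-s) := by positivity
    nlinarith [Real.one_le_rpow one_le_two hs]
  have hk : (0 : ℝ) < k + 1 := by positivity
  have habs : |(2 * k + 3) * fracInt (β + 1) x (legendre (k + 1))| ≤
      2 * (K * (2 ^ s * ((k : ℝ) + 1) ^ (-s))) := by
    rw [hrec]
    refine (abs_sub _ _).trans ?_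
    have := mul_le_mul_of_nonneg_left e0 hK
    have := mul_le_mul_of_nonneg_left e2 hK
    linarith
  rw [abs_mul, abs_of_pos (by positivity : (0 : ℝ) < 2 * k + 3)] at habs
  have hpow : ((k + 1 : ℕ) : ℝ) ^ (-(s + 1)) = ((k : ℝ) + 1) ^ (-s) / (k + 1) := by
    push_cast
    rw [neg_add, ← sub_eq_add_neg, Real.rpow_sub_one hk.ne']
  rw [hpow, ← mul_div_assoc, le_div_iff₀ hk]
  have := abs_nonneg (fracInt (β + 1) x (legendre (k + 1)))
  nlinarith

theorem FracBound.add_nat {β s : ℝ} {N : ℕ} (hs : 0 ≤ s) (h : FracBound β N s) (i : ℕ) :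
    FracBound (β + i) (N + i) (s + i) := by
  induction i with
  | zero => simpa using h
  | succ i ih =>
    have := ih.succ (by positivity)
    push_cast
    rwa [add_assoc, add_assoc, add_assoc] at this

theorem integral_sub_rpow {s a b r : ℝ} (h : -1 < r ∨ r ≠ -1 ∧ (0 : ℝ) ∉ uIcc (a - s) (b - s)) :
    ∫ x in a..b, (x - s) ^ r = ((b - s) ^ (r + 1) - (a - s) ^ (r + 1)) / (r + 1) := by
  rw [intervalIntegral.integral_comp_sub_right (fun x => x ^ r) s, integral_rpow h]

theorem abs_fracInt_interpolation {β δ M₀ M₁ h s : ℝ} (hβ : 0 ≤ β) (hδ : 0 < δ) (hδ1 : δ < 1)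
    (hh : 0 < h) (hs : s ∈ Icc (-1 : ℝ) 1) (R : ℝ[X])
    (h₀ : ∀ x ∈ Icc (-1 : ℝ) 1, |fracInt β x R| ≤ M₀)
    (h₁ : ∀ x ∈ Icc (-1 : ℝ) 1, |fracInt (β + 1) x R| ≤ M₁) :
    Real.Gamma δ * |fracInt (β + δ) s R| ≤ M₀ * (h ^ δ / δ) + 2 * M₁ * h ^ (δ - 1) := by
  have hM₀ : 0 ≤ M₀ := (abs_nonneg _).trans (h₀ s hs)
  have hM₁ : 0 ≤ M₁ := (abs_nonneg _).trans (h₁ s hs)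
  have hhδ : 0 < h ^ δ := Real.rpow_pos_of_pos hh _
  have hhδ1 : 0 < h ^ (δ - 1) := Real.rpow_pos_of_pos hh _
  rcases hs.2.eq_or_lt with rfl | hs1
  · rw [fracInt_at_one (by linarith), abs_zero, mul_zero]; positivity
  obtain ⟨hint, heq⟩ := fracInt_integral hδ (by linarith : -1 < β) hs1 R
  have hΓ := Real.Gamma_pos_of_pos hδ
  rw [← abs_of_pos hΓ, ← abs_mul, ← heq]
  set t := min (s + h) 1 with ht
  have hst : s < t := lt_min (by linarith) hs1
  have ht1 : t ≤ 1 := min_le_right _ _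
  have hth : t - s ≤ h := by have := min_le_left (s + h) 1; linarith
  have hsub : ∀ {a b}, a ∈ Icc s 1 → b ∈ Icc s 1 →
      IntervalIntegrable (fun x => (x - s) ^ (δ - 1) * fracInt β x R) volume a b := by
    intro a b ha hb
    refine hint.mono_set ?_
    rw [uIcc_of_le hs1.le]
    exact uIcc_subset_Icc ha hb
  have hts : t ∈ Icc s 1 := ⟨hst.le, ht1⟩
  rw [← intervalIntegral.integral_add_adjacent_intervals
    (hsub ⟨le_rfl, hs1.le⟩ hts) (hsub hts ⟨hs1.le, le_rfl⟩)]
  refine (abs_add_le _ _).trans (add_le_add ?_ ?_)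
  · have hI : ∫ x in s..t, (x - s) ^ (δ - 1) = (t - s) ^ δ / δ := by
      rw [integral_sub_rpow (Or.inl (by linarith)), sub_self, sub_add_cancel,
        Real.zero_rpow hδ.ne', sub_zero]
    have hbd : |∫ x in s..t, (x - s) ^ (δ - 1) * fracInt β x R| ≤
        ∫ x in s..t, (x - s) ^ (δ - 1) * M₀ := by
      rw [← Real.norm_eq_abs]
      refine intervalIntegral.norm_integral_le_of_norm_le hst.le
        (Eventually.of_forall fun x hx => ?_) ?_
      · have hx0 : 0 ≤ (x - s) ^ (δ - 1) := Real.rpow_nonneg (by linarith [hx.1]) _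
        rw [Real.norm_eq_abs, abs_mul, abs_of_nonneg hx0]
        exact mul_le_mul_of_nonneg_left (h₀ x ⟨by linarith [hx.1, hs.1], hx.2.trans ht1⟩) hx0
      · refine IntervalIntegrable.mul_const ?_ _
        have := (intervalIntegral.intervalIntegrable_rpow' (a := s - s) (b := t - s)
          (by linarith : -1 < δ - 1)).comp_sub_right s
        simpa using this
    rw [intervalIntegral.integral_mul_const, hI, mul_comm] at hbd
    refine hbd.trans ?_
    gcongr
  · rcases le_or_gt 1 (s + h) with hcase | hcase
    · have : t = 1 := min_eq_right hcase
      rw [this, intervalIntegral.integral_same, abs_zero]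
      positivity
    have htv : t = s + h := min_eq_left hcase.le
    have htlt : t < 1 := htv ▸ hcase
    have hpos : ∀ x ∈ Icc t 1, 0 < x - s := fun x hx => by linarith [hx.1]
    have hcont : ContinuousOn (fun x : ℝ => (x - s) ^ (δ - 2)) (Icc t 1) :=
      fun x hx => ((continuousAt_id.sub continuousAt_const).rpow_const
        (Or.inl (hpos x hx).ne')).continuousWithinAt
    have hcont1 : ContinuousOn (fun x : ℝ => (x - s) ^ (δ - 1)) (Icc t 1) :=
      fun x hx => ((continuousAt_id.sub continuousAt_const).rpow_const
        (Or.inl (hpos x hx).ne')).continuousWithinAt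
    have hJc := continuous_fracInt (β := β + 1) (by linarith) R
    have hi2 : IntervalIntegrable (fun x => (δ - 1) * ((x - s) ^ (δ - 2) * fracInt (β + 1) x R))
        volume t 1 := by
      refine ContinuousOn.intervalIntegrable ?_
      rw [uIcc_of_le ht1]
      exact continuousOn_const.mul (hcont.mul hJc.continuousOn)
    have hi1 := hsub hts ⟨hs1.le, le_rfl⟩
    have hd : ∀ x ∈ Ioo t 1, HasDerivAt (fun x => -((x - s) ^ (δ - 1) * fracInt (β + 1) x R))
        ((x - s) ^ (δ - 1) * fracInt β x R -
          (δ - 1) * ((x - s) ^ (δ - 2) * fracInt (β + 1) x R)) x := by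
      intro x hx
      have hxs := hpos x ⟨hx.1.le, hx.2.le⟩
      have e1 := ((hasDerivAt_id x).sub_const s).rpow_const (p := δ - 1) (Or.inl hxs.ne')
      refine (e1.mul (hasDerivAt_fracInt (by linarith : -1 < β) hx.2 R)).neg.congr_deriv ?_
      rw [show δ - 1 - 1 = δ - 2 by ring]
      simp only [id]
      ring
    have hftc := intervalIntegral.integral_eq_sub_of_hasDerivAt_of_le ht1
      ((hcont1.mul hJc.continuousOn).neg) hd (hi1.sub hi2)
    simp only [Pi.neg_apply, Pi.mul_apply] at hftc
    rw [intervalIntegral.integral_sub hi1 hi2, fracInt_at_one (β := β + 1) (by linarith),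
      intervalIntegral.integral_const_mul, show t - s = h by rw [htv]; ring] at hftc
    have hbd : |∫ x in t..1, (x - s) ^ (δ - 2) * fracInt (β + 1) x R| ≤
        ∫ x in t..1, (x - s) ^ (δ - 2) * M₁ := by
      rw [← Real.norm_eq_abs]
      refine intervalIntegral.norm_integral_le_of_norm_le ht1
        (Eventually.of_forall fun x hx => ?_) ?_
      · have hx0 : 0 ≤ (x - s) ^ (δ - 2) := Real.rpow_nonneg (by linarith [hx.1]) _
        rw [Real.norm_eq_abs, abs_mul, abs_of_nonneg hx0]
        exact mul_le_mul_of_nonneg_left (h₁ x ⟨by linarith [hx.1, hs.1], hx.2⟩) hx0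
      · refine ContinuousOn.intervalIntegrable ?_
        rw [uIcc_of_le ht1]
        exact hcont.mul continuousOn_const
    have hI : ∫ x in t..1, (x - s) ^ (δ - 2) = (h ^ (δ - 1) - (1 - s) ^ (δ - 1)) / (1 - δ) := by
      rw [integral_sub_rpow, show t - s = h by rw [htv]; ring, show δ - 2 + 1 = δ - 1 by ring,
        ← neg_sub δ 1, div_neg, ← neg_div, neg_sub]
      refine Or.inr ⟨by linarith, ?_⟩
      rw [uIcc_of_le (by linarith)]
      exact fun h0 => by linarith [h0.1]
    rw [intervalIntegral.integral_mul_const, hI, div_mul_eq_mul_div,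
      le_div_iff₀ (by linarith)] at hbd
    have hs0 : 0 ≤ (1 - s) ^ (δ - 1) := Real.rpow_nonneg (by linarith) _
    have ht2 := h₁ t ⟨by linarith [hs.1], ht1⟩
    have hval : ∫ x in t..1, (x - s) ^ (δ - 1) * fracInt β x R =
        h ^ (δ - 1) * fracInt (β + 1) t R -
          (1 - δ) * ∫ x in t..1, (x - s) ^ (δ - 2) * fracInt (β + 1) x R := by
      linear_combination hftc
    rw [hval]
    refine (abs_sub _ _).trans ?_
    rw [abs_mul, abs_mul, abs_of_pos hhδ1, abs_of_pos (by linarith : 0 < 1 - δ)]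
    have := mul_le_mul_of_nonneg_left ht2 hhδ1.le
    have := mul_nonneg hs0 hM₁
    nlinarith

theorem FracBound.interpolate {β δ s : ℝ} {N : ℕ} (hβ : 0 ≤ β) (hs : 0 ≤ s) (hδ : 0 < δ)
    (hδ1 : δ < 1) (h : FracBound β N s) : FracBound (β + δ) (N + 1) (s + δ) := by
  obtain ⟨K₁, hK₁, h₁⟩ := h.succ hs
  obtain ⟨K₀, hK₀, h₀⟩ := h
  have hΓ := Real.Gamma_pos_of_pos hδ
  refine ⟨(K₀ / δ + 2 * K₁) / Real.Gamma δ, by positivity, fun n hn x hx => ?_⟩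
  have hn0 : (0 : ℝ) < n := by exact_mod_cast (by omega : 0 < n)
  have key := abs_fracInt_interpolation hβ hδ hδ1 (inv_pos.2 hn0) hx (legendre n)
    (h₀ n (by omega)) (h₁ n hn)
  rw [div_mul_eq_mul_div, le_div_iff₀ hΓ, mul_comm]
  refine key.trans (le_of_eq ?_)
  rw [Real.inv_rpow hn0.le, ← Real.rpow_neg hn0.le, Real.inv_rpow hn0.le, ← Real.rpow_neg hn0.le]
  have e1 : (n : ℝ) ^ (-(s + δ)) = (n : ℝ) ^ (-s) * (n : ℝ) ^ (-δ) := by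
    rw [← Real.rpow_add hn0]; ring_nf
  have e2 : (n : ℝ) ^ (-(s + δ)) = (n : ℝ) ^ (-(s + 1)) * (n : ℝ) ^ (-(δ - 1)) := by
    rw [← Real.rpow_add hn0]; ring_nf
  calc _ = K₀ / δ * ((n : ℝ) ^ (-s) * (n : ℝ) ^ (-δ)) +
        2 * K₁ * ((n : ℝ) ^ (-(s + 1)) * (n : ℝ) ^ (-(δ - 1))) := by ring
    _ = _ := by rw [← e1, ← e2]; ring

/-- For non-integral `γ > 0`, the fractional integrals of order `γ` decay like `n ^ (-γ)`. -/
theorem fracBound_order {γ : ℝ} {j : ℕ} (h1 : (j : ℝ) < γ) (h2 : γ < j + 1) :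
    FracBound γ (j + 1) γ := by
  have := (fracBound_zero.add_nat le_rfl j).interpolate (by positivity) (by positivity)
    (sub_pos.2 h1) (by linarith)
  simpa using this

/-- For non-integral `γ > 0`, the fractional integrals of order `γ + 1` decay like
`n ^ (-(γ + 3/2))`. -/
theorem fracBound_order_add_one {γ : ℝ} {j : ℕ} (h1 : (j : ℝ) < γ) (h2 : γ < j + 1) :
    FracBound (γ + 1) (j + 2) (γ + 3 / 2) := by
  have := (fracBound_one.add_nat (by norm_num) j).interpolate (by positivity) (by positivity)
    (sub_pos.2 h1) (by linarith)
  convert this using 1 <;> ring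

theorem Gamma_mul_fracInt_neg_one {β : ℝ} (hβ : 0 < β) (R : ℝ[X]) :
    Real.Gamma β * fracInt β (-1) R = ∫ x in (-1 : ℝ)..1, (1 + x) ^ (β - 1) * R.eval x := by
  have h := (fracInt_integral (β := 0) hβ (by norm_num) (by norm_num : (-1 : ℝ) < 1) R).2
  rw [zero_add] at h
  rw [← h]
  refine intervalIntegral.integral_congr fun x _ => ?_
  simp only [fracInt_zero, sub_neg_eq_add, add_comm]

theorem fracInt_neg_one_legendre_succ {β : ℝ} (hβ : 0 < β) (n : ℕ) :
    (n + 1 + β) * fracInt β (-1) (legendre (n + 1)) =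
      (β - 1 - n) * fracInt β (-1) (legendre n) := by
  have h := moment_legendre_succ (b := β - 1) (by linarith) n
  rw [← Gamma_mul_fracInt_neg_one hβ, ← Gamma_mul_fracInt_neg_one hβ] at h
  have hΓ := (Real.Gamma_pos_of_pos hβ).ne'
  refine mul_left_cancel₀ hΓ ?_
  linear_combination h

theorem fracInt_neg_one_legendre_eq_zero {i n : ℕ} (hi : 1 ≤ i) (hn : i ≤ n) :
    fracInt i (-1) (legendre n) = 0 := by
  obtain ⟨j, rfl⟩ := Nat.exists_eq_add_of_le' hi
  have hpos : (0 : ℝ) < ((j + 1 : ℕ) : ℝ) := by positivity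
  have h := Gamma_mul_fracInt_neg_one hpos (legendre n)
  rw [show (((j + 1 : ℕ) : ℝ) - 1) = (j : ℝ) by push_cast; ring,
    moment_legendre_eq_zero (by omega)] at h
  exact (mul_eq_zero.1 h).resolve_left (Real.Gamma_pos_of_pos hpos).ne'

theorem one_sub_div_one_add_le_exp {t : ℝ} (h0 : 0 ≤ t) (h1 : t < 1) :
    (1 - t) / (1 + t) ≤ Real.exp (-(2 * t)) := by
  have hs := Real.hasSum_log_sub_log_of_abs_lt_one (x := t) (by rwa [abs_of_nonneg h0])
  have hle := le_hasSum hs 0 fun i _ => by positivity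
  norm_num at hle
  rw [← Real.exp_log (by linarith : 0 < 1 - t), ← Real.exp_log (by linarith : 0 < 1 + t),
    ← Real.exp_sub]
  exact Real.exp_le_exp.2 (by linarith)

theorem exp_neg_two_mul_div_le {β x : ℝ} (hβ : 0 ≤ β) (hx : 0 < x) :
    Real.exp (-(2 * (β / x))) ≤ (x / (x + 1)) ^ (2 * β) := by
  have h : Real.exp (-x⁻¹) ≤ x / (x + 1) := by
    rw [Real.exp_neg, inv_le_comm₀ (Real.exp_pos _) (by positivity), inv_div]
    have := Real.add_one_le_exp x⁻¹
    calc (x + 1) / x = x⁻¹ + 1 := by field_simp; ring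
      _ ≤ _ := this
  calc Real.exp (-(2 * (β / x))) = Real.exp (-x⁻¹) ^ (2 * β) := by
        rw [← Real.exp_mul]; congr 1; field_simp
    _ ≤ _ := Real.rpow_le_rpow (Real.exp_pos _).le h (by positivity)

theorem exists_abs_fracInt_neg_one_legendre_le {β : ℝ} (hβ : 0 < β) :
    ∃ K : ℝ, 0 ≤ K ∧ ∀ n : ℕ, |fracInt β (-1) (legendre n)| ≤ K * ((n : ℝ) + 1) ^ (-(2 * β)) := by
  obtain ⟨N, hN⟩ := exists_nat_gt β
  set a : ℕ → ℝ := fun n => |fracInt β (-1) (legendre n)| * ((n : ℝ) + 1) ^ (2 * β) with ha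
  have ha0 : ∀ n, 0 ≤ a n := fun n => by positivity
  have hstep : ∀ n, N ≤ n → a (n + 1) ≤ a n := by
    intro n hn
    have hn' : (N : ℝ) ≤ n := by exact_mod_cast hn
    have hx : (0 : ℝ) < (n : ℝ) + 1 := by positivity
    have hrec := fracInt_neg_one_legendre_succ hβ n
    have ht1 : β / ((n : ℝ) + 1) < 1 := by rw [div_lt_one hx]; linarith
    have hratio : |fracInt β (-1) (legendre (n + 1))| =
        (1 - β / ((n : ℝ) + 1)) / (1 + β / ((n : ℝ) + 1)) * |fracInt β (-1) (legendre n)| := by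
      have h1 := congrArg abs hrec
      rw [abs_mul, abs_mul, abs_of_pos (by positivity), abs_of_neg (a := β - 1 - n) (by linarith)]
        at h1
      have e : (1 - β / ((n : ℝ) + 1)) / (1 + β / ((n : ℝ) + 1)) =
          (n + 1 - β) / (n + 1 + β) := by field_simp
      rw [e, div_mul_eq_mul_div, eq_div_iff (by positivity)]
      linear_combination h1
    have hle := (one_sub_div_one_add_le_exp (by positivity) ht1).trans
      (exp_neg_two_mul_div_le hβ.le hx)
    simp only [ha]
    push_cast
    rw [hratio]
    calc _ ≤ (((n : ℝ) + 1) / (n + 1 + 1)) ^ (2 * β) * |fracInt β (-1) (legendre n)| *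
          ((n : ℝ) + 1 + 1) ^ (2 * β) := by gcongr
      _ = _ := by
        rw [Real.div_rpow (by positivity) (by positivity)]
        have : ((n : ℝ) + 1 + 1) ^ (2 * β) ≠ 0 := by positivity
        field_simp
  refine ⟨∑ i ∈ Finset.range (N + 1), a i, Finset.sum_nonneg fun i _ => ha0 i, fun n => ?_⟩
  have hmain : a n ≤ ∑ i ∈ Finset.range (N + 1), a i := by
    rcases le_or_gt n N with h | h
    · exact Finset.single_le_sum (fun i _ => ha0 i) (Finset.mem_range.2 (by omega))
    · refine le_trans ?_ (Finset.single_le_sum (fun i _ => ha0 i)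
        (Finset.mem_range.2 (Nat.lt_succ_self N)))
      induction n, h.le using Nat.le_induction with
      | base => exact le_rfl
      | succ n hn ih =>
        rcases hn.eq_or_lt with rfl | hlt
        · exact hstep _ le_rfl
        · exact (hstep n hn).trans (ih hlt)
  rw [Real.rpow_neg (by positivity), ← div_eq_mul_inv, le_div_iff₀ (by positivity)]
  exact hmain

theorem exists_abs_fracInt_neg_one_legendre_add_le {β : ℝ} (hβ : 0 < β) :
    ∃ K : ℝ, 0 ≤ K ∧ ∀ n : ℕ, |fracInt β (-1) (legendre n + legendre (n + 1))| ≤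
      K * ((n : ℝ) + 1) ^ (-(2 * β + 1)) := by
  obtain ⟨K, hK, h⟩ := exists_abs_fracInt_neg_one_legendre_le hβ
  refine ⟨2 * β * K, by positivity, fun n => ?_⟩
  have hrec := fracInt_neg_one_legendre_succ hβ n
  have e : fracInt β (-1) (legendre n + legendre (n + 1)) =
      2 * β * fracInt β (-1) (legendre n) / (n + 1 + β) := by
    rw [map_add, eq_div_iff (by positivity)]
    linear_combination hrec
  have hx : (0 : ℝ) < (n : ℝ) + 1 := by positivity
  rw [e, abs_div, abs_mul, abs_of_pos (by positivity : (0 : ℝ) < n + 1 + β),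
    abs_of_pos (by positivity : 0 < 2 * β), div_le_iff₀ (by positivity), neg_add,
    Real.rpow_add hx, Real.rpow_neg_one]
  calc 2 * β * |fracInt β (-1) (legendre n)|
      ≤ 2 * β * (K * ((n : ℝ) + 1) ^ (-(2 * β))) := by gcongr; exact h n
    _ = 2 * β * K * (((n : ℝ) + 1) ^ (-(2 * β)) * ((n : ℝ) + 1)⁻¹) * (n + 1) := by field_simp
    _ ≤ _ := mul_le_mul_of_nonneg_left (by linarith) (by positivity)

/-- A function on `(-1, 1)` with integrable derivative extends continuously to `[-1, 1]`. -/
theorem exists_continuousOn_eqOn {f f' : ℝ → ℝ}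
    (hd : ∀ x ∈ Ioo (-1 : ℝ) 1, HasDerivAt f (f' x) x)
    (hi : IntervalIntegrable f' volume (-1) 1) :
    ∃ F : ℝ → ℝ, ContinuousOn F (Icc (-1) 1) ∧ EqOn f F (Ioo (-1) 1) := by
  refine ⟨fun x => f 0 + ∫ t in (0 : ℝ)..x, f' t, ?_, fun x hx => ?_⟩
  · refine continuousOn_const.add ?_
    have := intervalIntegral.continuousOn_primitive_interval' (a := 0) hi
      (by rw [uIcc_of_le (by norm_num)]; norm_num)
    rwa [uIcc_of_le (by norm_num)] at this
  · have hsub : uIcc 0 x ⊆ Ioo (-1 : ℝ) 1 :=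
      ordConnected_Ioo.uIcc_subset (by norm_num) hx
    have h := intervalIntegral.integral_eq_sub_of_hasDerivAt (fun y hy => hd y (hsub hy))
      (hi.mono_set (by
        rw [uIcc_of_le (by norm_num : (-1 : ℝ) ≤ 1)]; exact hsub.trans Ioo_subset_Icc_self))
    simp only [h]
    ring

theorem exists_tendsto_nhdsGT {f f' : ℝ → ℝ}
    (hd : ∀ x ∈ Ioo (-1 : ℝ) 1, HasDerivAt f (f' x) x)
    (hi : IntervalIntegrable f' volume (-1) 1) :
    ∃ A, Tendsto f (nhdsWithin (-1 : ℝ) (Ioi (-1))) (nhds A) := by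
  obtain ⟨F, hF, hfF⟩ := exists_continuousOn_eqOn hd hi
  refine ⟨F (-1), ?_⟩
  have h := (hF (-1) (by norm_num)).mono_left
    (nhdsWithin_mono (-1 : ℝ) (Ioo_subset_Icc_self : Ioo (-1 : ℝ) 1 ⊆ Icc (-1) 1))
  rw [nhdsWithin_Ioo_eq_nhdsGT (by norm_num)] at h
  refine h.congr' ?_
  filter_upwards [Ioo_mem_nhdsGT (by norm_num : (-1 : ℝ) < 1)] with x hx using (hfF hx).symm

theorem integral_mul_fracInt {f f' : ℝ → ℝ} {A b : ℝ} (hb : -1 < b)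
    (hd : ∀ x ∈ Ioo (-1 : ℝ) 1, HasDerivAt f (f' x) x)
    (hi : IntervalIntegrable f' volume (-1) 1)
    (hA : Tendsto f (nhdsWithin (-1 : ℝ) (Ioi (-1))) (nhds A)) (R : ℝ[X]) :
    ∫ x in (-1 : ℝ)..1, f x * fracInt b x R =
      A * fracInt (b + 1) (-1) R + ∫ x in (-1 : ℝ)..1, f' x * fracInt (b + 1) x R := by
  obtain ⟨F, hF, hfF⟩ := exists_continuousOn_eqOn hd hi
  have hFA : F (-1) = A := by
    have h := (hF (-1) (by norm_num)).mono_left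
      (nhdsWithin_mono (-1 : ℝ) (Ioo_subset_Icc_self : Ioo (-1 : ℝ) 1 ⊆ Icc (-1) 1))
    rw [nhdsWithin_Ioo_eq_nhdsGT (by norm_num)] at h
    refine tendsto_nhds_unique h (hA.congr' ?_)
    filter_upwards [Ioo_mem_nhdsGT (by norm_num : (-1 : ℝ) < 1)] with x hx using hfF hx
  have hJ := continuous_fracInt (β := b + 1) (by linarith) R
  have hi1 : IntervalIntegrable (fun x => f' x * fracInt (b + 1) x R) volume (-1) 1 :=
    hi.mul_continuousOn hJ.continuousOn
  have hi2 : IntervalIntegrable (fun x => F x * fracInt b x R) volume (-1) 1 :=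
    (intervalIntegrable_fracInt hb R _ _).continuousOn_mul
      (by rwa [uIcc_of_le (by norm_num : (-1 : ℝ) ≤ 1)])
  have hftc := intervalIntegral.integral_eq_sub_of_hasDerivAt_of_le (by norm_num : (-1 : ℝ) ≤ 1)
    (hF.mul hJ.continuousOn) (f' := fun x => f' x * fracInt (b + 1) x R - F x * fracInt b x R)
    (fun x hx => by
      have hFd : HasDerivAt F (f' x) x := (hd x hx).congr_of_eventuallyEq
        (by filter_upwards [Ioo_mem_nhds hx.1 hx.2] with y hy using (hfF hy).symm)
      exact (hFd.mul (hasDerivAt_fracInt hb hx.2 R)).congr_deriv (by ring)) (hi1.sub hi2)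
  simp only [Pi.mul_apply] at hftc
  rw [intervalIntegral.integral_sub hi1 hi2, fracInt_at_one (β := b + 1) (by linarith), hFA]
    at hftc
  have hcongr : ∫ x in (-1 : ℝ)..1, f x * fracInt b x R =
      ∫ x in (-1 : ℝ)..1, F x * fracInt b x R := by
    rw [intervalIntegral.integral_of_le (by norm_num), intervalIntegral.integral_of_le (by norm_num),
      integral_Ioc_eq_integral_Ioo, integral_Ioc_eq_integral_Ioo]
    exact setIntegral_congr_fun measurableSet_Ioo fun x hx => by simp only [hfF hx]
  rw [hcongr]
  linear_combination -hftc

theorem integral_mul_fracInt_iterate {G : ℕ → ℝ → ℝ} {L : ℕ → ℝ} {b : ℝ} (hb : -1 < b) (m : ℕ)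
    (hd : ∀ i < m, ∀ x ∈ Ioo (-1 : ℝ) 1, HasDerivAt (G i) (G (i + 1) x) x)
    (hi : ∀ i ≤ m, IntervalIntegrable (G i) volume (-1) 1)
    (hL : ∀ i < m, Tendsto (G i) (nhdsWithin (-1 : ℝ) (Ioi (-1))) (nhds (L i))) (R : ℝ[X]) :
    ∫ x in (-1 : ℝ)..1, G 0 x * fracInt b x R =
      ∑ i ∈ Finset.range m, L i * fracInt (b + i + 1) (-1) R +
        ∫ x in (-1 : ℝ)..1, G m x * fracInt (b + m) x R := by
  induction m with
  | zero => simp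
  | succ m ih =>
    rw [ih (fun i h => hd i (by omega)) (fun i h => hi i (by omega)) (fun i h => hL i (by omega)),
      integral_mul_fracInt (lt_add_of_lt_of_nonneg hb m.cast_nonneg) (hd m m.lt_succ_self)
        (hi _ le_rfl) (hL m m.lt_succ_self), Finset.sum_range_succ]
    push_cast
    rw [add_assoc b, add_assoc]

theorem integral_primitive_rpow_mul_one_sub_rpow {θ r : ℝ} (hθ : 0 < θ) (hr : -1 < r)
    (hθr : 0 ≤ θ + r) {w : ℝ → ℝ} (hw : IntervalIntegrable w volume (-1) 1) :
    IntervalIntegrable (fun x => (∫ y in (-1 : ℝ)..x, (x - y) ^ (θ - 1) * w y) * (1 - x) ^ r)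
        volume (-1) 1 ∧
      ∫ x in (-1 : ℝ)..1, (∫ y in (-1 : ℝ)..x, (x - y) ^ (θ - 1) * w y) * (1 - x) ^ r =
        Real.Gamma θ * Real.Gamma (r + 1) / Real.Gamma (θ + (r + 1)) *
          ∫ y in (-1 : ℝ)..1, w y * (1 - y) ^ (θ + r) := by
  have h11 : (-1 : ℝ) ≤ 1 := by norm_num
  set c := Real.Gamma θ * Real.Gamma (r + 1) / Real.Gamma (θ + (r + 1)) with hc
  set μ := (volume : Measure ℝ).restrict (Ioo (-1 : ℝ) 1) with hμ
  set S : Set (ℝ × ℝ) := {z | z.2 < z.1} with hS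
  have hSm : MeasurableSet S := measurableSet_lt measurable_snd measurable_fst
  set h : ℝ × ℝ → ℝ := S.indicator
    (fun z => (z.1 - z.2) ^ (θ - 1) * (1 - z.1) ^ r * w z.2) with hh
  have hwμ : Integrable w μ := (intervalIntegrable_iff_integrableOn_Ioo_of_le h11).1 hw
  have hmeas : AEStronglyMeasurable h (μ.prod μ) := by
    refine AEStronglyMeasurable.indicator ?_ hSm
    refine AEStronglyMeasurable.mul ?_ hwμ.aestronglyMeasurable.comp_snd
    exact (by fun_prop : Measurable fun z : ℝ × ℝ =>
      (z.1 - z.2) ^ (θ - 1) * (1 - z.1) ^ r).aestronglyMeasurable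
  have hcol : ∀ y, (fun x => h (x, y)) = (Ioi y).indicator
      (fun x => (x - y) ^ (θ - 1) * (1 - x) ^ r * w y) := by
    intro y; ext x; simp [hh, hS, indicator]
  have hrow : ∀ x, (fun y => h (x, y)) = (Iio x).indicator
      (fun y => (x - y) ^ (θ - 1) * (1 - x) ^ r * w y) := by
    intro x; ext y; simp [hh, hS, indicator]
  have hcolint : ∀ y ∈ Ioo (-1 : ℝ) 1, IntegrableOn
      (fun x => (x - y) ^ (θ - 1) * (1 - x) ^ r) (Ioo y 1) := fun y hy =>
    (intervalIntegrable_iff_integrableOn_Ioo_of_le hy.2.le).1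
      (intervalIntegrable_sub_rpow_mul_one_sub_rpow hθ hr hy.2)
  have hinter : ∀ y ∈ Ioo (-1 : ℝ) 1, Ioi y ∩ Ioo (-1 : ℝ) 1 = Ioo y 1 := by
    intro y hy; ext x; simp only [mem_inter_iff, mem_Ioi, mem_Ioo]
    exact ⟨fun h => ⟨h.1, h.2.2⟩, fun h => ⟨h.1, hy.1.trans h.1, h.2⟩⟩
  have hinter' : ∀ x ∈ Ioo (-1 : ℝ) 1, Iio x ∩ Ioo (-1 : ℝ) 1 = Ioo (-1) x := by
    intro y hy; ext x; simp only [mem_inter_iff, mem_Iio, mem_Ioo]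
    exact ⟨fun h => ⟨h.2.1, h.1⟩, fun h => ⟨h.2, h.1, h.2.trans hy.2⟩⟩
  have hcolval : ∀ y ∈ Ioo (-1 : ℝ) 1, ∀ a : ℝ,
      ∫ x, (Ioi y).indicator (fun x => (x - y) ^ (θ - 1) * (1 - x) ^ r * a) x ∂μ =
        c * (a * (1 - y) ^ (θ + r)) := by
    intro y hy a
    rw [integral_indicator measurableSet_Ioi, hμ, Measure.restrict_restrict measurableSet_Ioi,
      hinter y hy, integral_mul_const, ← integral_Ioc_eq_integral_Ioo,
      ← intervalIntegral.integral_of_le hy.2.le, integral_sub_rpow_mul_one_sub_rpow hθ hr hy.2]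
    ring
  have hbdd : Continuous fun y : ℝ => (1 - y) ^ (θ + r) :=
    (continuous_const.sub continuous_id).rpow_const fun _ => Or.inr hθr
  have hint : Integrable h (μ.prod μ) := by
    rw [integrable_prod_iff' hmeas]
    constructor
    · filter_upwards [ae_restrict_mem measurableSet_Ioo] with y hy
      rw [hcol, integrable_indicator_iff measurableSet_Ioi, IntegrableOn, hμ,
        Measure.restrict_restrict measurableSet_Ioi, hinter y hy]
      exact (hcolint y hy).mul_const _
    · have : Integrable (fun y => c * (|w y| * (1 - y) ^ (θ + r))) μ := by
        refine Integrable.const_mul ?_ _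
        exact (intervalIntegrable_iff_integrableOn_Ioo_of_le h11).1
          (hw.abs.mul_continuousOn hbdd.continuousOn)
      refine this.congr ?_
      filter_upwards [ae_restrict_mem measurableSet_Ioo] with y hy
      rw [← hcolval y hy]
      refine integral_congr_ae ?_
      filter_upwards [ae_restrict_mem measurableSet_Ioo] with x hx
      rw [show h (x, y) = _ from congrFun (hcol y) x]
      by_cases hxy : x ∈ Ioi y
      · rw [indicator_of_mem hxy, indicator_of_mem hxy, Real.norm_eq_abs, abs_mul,
          abs_of_nonneg (mul_nonneg (Real.rpow_nonneg (sub_nonneg.2 (le_of_lt hxy)) _)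
            (Real.rpow_nonneg (sub_nonneg.2 hx.2.le) _))]
      · rw [indicator_of_notMem hxy, indicator_of_notMem hxy, norm_zero]
  have hrowval : ∀ x ∈ Ioo (-1 : ℝ) 1, ∫ y, h (x, y) ∂μ =
      (∫ y in (-1 : ℝ)..x, (x - y) ^ (θ - 1) * w y) * (1 - x) ^ r := by
    intro x hx
    rw [hrow, integral_indicator measurableSet_Iio, hμ, Measure.restrict_restrict measurableSet_Iio,
      hinter' x hx, ← integral_Ioc_eq_integral_Ioo, ← intervalIntegral.integral_of_le hx.1.le,
      ← intervalIntegral.integral_mul_const]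
    exact intervalIntegral.integral_congr fun y _ => by ring
  constructor
  · rw [intervalIntegrable_iff_integrableOn_Ioo_of_le h11]
    refine hint.integral_prod_left.congr ?_
    filter_upwards [ae_restrict_mem measurableSet_Ioo] with x hx using hrowval x hx
  · have hswap := integral_integral_swap (f := fun x y => h (x, y)) hint
    rw [intervalIntegral.integral_of_le h11, intervalIntegral.integral_of_le h11,
      integral_Ioc_eq_integral_Ioo, integral_Ioc_eq_integral_Ioo, ← integral_const_mul]
    rw [← setIntegral_congr_fun measurableSet_Ioo hrowval, hswap]
    refine setIntegral_congr_fun measurableSet_Ioo fun y hy => ?_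
    simp only [hcol]
    exact hcolval y hy _

theorem integral_primitive_rpow_mul_fracInt {θ b : ℝ} (hθ : 0 < θ) (hb : -1 < b)
    (hθb : 0 ≤ b + θ) {w : ℝ → ℝ} (hw : IntervalIntegrable w volume (-1) 1) (R : ℝ[X]) :
    IntervalIntegrable
        (fun x => (∫ y in (-1 : ℝ)..x, (x - y) ^ (θ - 1) * w y) * fracInt b x R) volume (-1) 1 ∧
      ∫ x in (-1 : ℝ)..1, (∫ y in (-1 : ℝ)..x, (x - y) ^ (θ - 1) * w y) * fracInt b x R =
        Real.Gamma θ * ∫ y in (-1 : ℝ)..1, w y * fracInt (b + θ) y R := by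
  have hwi : ∀ p : ℝ[X], IntervalIntegrable (fun y => w y * fracInt (b + θ) y p) volume (-1) 1 :=
    fun p => hw.mul_continuousOn (continuous_fracInt hθb p).continuousOn
  induction R using one_sub_X_pow_induction with
  | add p q hp hq =>
    simp only [map_add, mul_add]
    refine ⟨hp.1.add hq.1, ?_⟩
    rw [intervalIntegral.integral_add hp.1 hq.1, hp.2, hq.2,
      intervalIntegral.integral_add (hwi p) (hwi q), mul_add]
  | smul a p hp =>
    simp only [map_smul, smul_eq_mul, mul_left_comm _ a]
    refine ⟨hp.1.const_mul a, ?_⟩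
    rw [intervalIntegral.integral_const_mul, intervalIntegral.integral_const_mul, hp.2,
      mul_left_comm]
  | pow l =>
    have h0 := Nat.cast_nonneg (α := ℝ) l
    have hl : -1 < (l : ℝ) + b := by linarith
    obtain ⟨h1, h2⟩ := integral_primitive_rpow_mul_one_sub_rpow hθ hl (by linarith) hw
    simp only [fracInt_one_sub_X_pow, mul_left_comm _ (Real.Gamma _ / Real.Gamma _)]
    refine ⟨h1.const_mul _, ?_⟩
    rw [intervalIntegral.integral_const_mul, intervalIntegral.integral_const_mul, h2]
    have h3 := (Real.Gamma_pos_of_pos (show 0 < (l : ℝ) + b + 1 by linarith)).ne'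
    have h4 := (Real.Gamma_pos_of_pos (show 0 < θ + ((l : ℝ) + b + 1) by linarith)).ne'
    rw [show (l : ℝ) + 1 + b = l + b + 1 by ring,
      show (l : ℝ) + 1 + (b + θ) = θ + (l + b + 1) by ring,
      show (l : ℝ) + (b + θ) = θ + (l + b) by ring]
    field_simp

theorem integral_iteratedDeriv_mul_eval {k : ℕ} {ω : ℝ → ℝ}
    (hd : ∀ i < k, ∀ x ∈ Ioo (-1 : ℝ) 1,
      HasDerivAt (iteratedDeriv i ω) (iteratedDeriv (i + 1) ω x) x)
    (hi : ∀ i ≤ k, IntervalIntegrable (iteratedDeriv i ω) volume (-1) 1) {j : ℕ} (hj : j ≤ k)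
    {R : ℝ[X]} (hR : ∀ i : ℕ, 1 ≤ i → i + j ≤ k → fracInt i (-1) R = 0) :
    ∫ x in (-1 : ℝ)..1, iteratedDeriv j ω x * R.eval x =
      ∫ x in (-1 : ℝ)..1, iteratedDeriv k ω x * fracInt ((k : ℝ) - j) x R := by
  have hlim : ∀ i, ∃ A, i < k - j →
      Tendsto (iteratedDeriv (j + i) ω) (nhdsWithin (-1 : ℝ) (Ioi (-1))) (nhds A) := by
    intro i
    by_cases h : i < k - j
    · obtain ⟨A, hA⟩ := exists_tendsto_nhdsGT (hd (j + i) (by omega)) (hi _ (by omega))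
      exact ⟨A, fun _ => hA⟩
    · exact ⟨0, fun h' => absurd h' h⟩
  choose A hA using hlim
  have h := integral_mul_fracInt_iterate (G := fun i => iteratedDeriv (j + i) ω) (L := A) (b := 0)
    (by norm_num) (k - j) (fun i h => hd (j + i) (by omega)) (fun i h => hi _ (by omega)) hA R
  rw [Finset.sum_eq_zero, zero_add] at h
  · simpa only [fracInt_zero, add_zero, Nat.add_sub_cancel' hj, zero_add, Nat.cast_sub hj] using h
  · intro i hi
    have := hR (i + 1) (by omega) (by have := Finset.mem_range.1 hi; omega)
    push_cast at this
    rw [zero_add, this, mul_zero]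

theorem integral_iteratedDeriv_mul_fracInt {k m : ℕ} {α : ℝ} {ω : ℝ → ℝ} {L : ℕ → ℝ}
    (hα : α < k) (hω : MemUL k m α ω L) {b : ℝ} (hb : -1 < b) (hbk : 0 ≤ b + (k - α)) (R : ℝ[X]) :
    ∫ x in (-1 : ℝ)..1, iteratedDeriv k ω x * fracInt (b + (k - α)) x R =
      ∑ i ∈ Finset.range m, L i * fracInt (b + i + 1) (-1) R +
        ∫ x in (-1 : ℝ)..1, iteratedDeriv m (caputoL k α (-1) ω) x * fracInt (b + m) x R := by
  obtain ⟨-, -, hi, hdg, hig, hL⟩ := hω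
  have h := integral_mul_fracInt_iterate (G := fun i => iteratedDeriv i (caputoL k α (-1) ω))
    hb m hdg hig hL R
  rw [← h]
  have hθ : 0 < (k : ℝ) - α := sub_pos.2 hα
  have hsw := (integral_primitive_rpow_mul_fracInt hθ hb hbk (hi k le_rfl) R).2
  simp only [iteratedDeriv_zero, caputoL, mul_assoc]
  rw [intervalIntegral.integral_const_mul, hsw, one_div,
    inv_mul_cancel_left₀ (Real.Gamma_pos_of_pos hθ).ne']

theorem usemiL_nonneg (k m : ℕ) (α : ℝ) (ω : ℝ → ℝ) (L : ℕ → ℝ) : 0 ≤ UsemiL k m α ω L :=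
  add_nonneg (intervalIntegral.integral_nonneg (by norm_num) fun _ _ => abs_nonneg _)
    (Finset.sum_nonneg fun _ _ => abs_nonneg _)

/-- The pairing of `ω^{(j)}` with a polynomial is bounded by the fractional semi-norm. -/
theorem abs_integral_iteratedDeriv_mul_le {k m j : ℕ} {α M : ℝ} {ω : ℝ → ℝ} {L : ℕ → ℝ}
    (hα : α < k) (hω : MemUL k m α ω L) (hj : j ≤ k) (hjα : (j : ℝ) < α + 1)
    {R : ℝ[X]}
    (hR : ∀ i : ℕ, 1 ≤ i → i + j ≤ k → fracInt i (-1) R = 0)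
    (hM : ∀ i < m, |fracInt (α - j + i + 1) (-1) R| ≤ M)
    (hM' : ∀ x ∈ Icc (-1 : ℝ) 1, |fracInt (α - j + m) x R| ≤ M) :
    |∫ x in (-1 : ℝ)..1, iteratedDeriv j ω x * R.eval x| ≤ M * UsemiL k m α ω L := by
  have hjk : (j : ℝ) ≤ k := by exact_mod_cast hj
  rw [integral_iteratedDeriv_mul_eval hω.2.1 hω.2.2.1 hj hR,
    show (k : ℝ) - j = α - j + (k - α) by ring,
    integral_iteratedDeriv_mul_fracInt hα hω (by linarith) (by linarith), add_comm, UsemiL,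
    mul_add]
  refine (abs_add_le _ _).trans (add_le_add ?_ ?_)
  · rw [← intervalIntegral.integral_const_mul, ← Real.norm_eq_abs]
    refine intervalIntegral.norm_integral_le_of_norm_le (by norm_num)
      (Eventually.of_forall fun x hx => ?_) ?_
    · rw [Real.norm_eq_abs, abs_mul, mul_comm]
      exact mul_le_mul_of_nonneg_right (hM' x ⟨hx.1.le, hx.2⟩) (abs_nonneg _)
    · exact (hω.2.2.2.2.1 m le_rfl).abs.const_mul M
  · rw [Finset.mul_sum]
    refine (Finset.abs_sum_le_sum_abs _ _).trans (Finset.sum_le_sum fun i hi => ?_)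
    rw [abs_mul, mul_comm]
    exact mul_le_mul_of_nonneg_right (hM i (Finset.mem_range.1 hi)) (abs_nonneg _)

theorem rpow_neg_add_one_le_rpow_neg {n : ℕ} (hn : 1 ≤ n) {s t : ℝ} (hst : t ≤ s) (hs : 0 ≤ s) :
    ((n : ℝ) + 1) ^ (-s) ≤ (n : ℝ) ^ (-t) := by
  have hn' : (1 : ℝ) ≤ n := by exact_mod_cast hn
  exact (Real.rpow_le_rpow_of_nonpos (by linarith) (by linarith) (by linarith)).trans
    (Real.rpow_le_rpow_of_exponent_le hn' (by linarith))

/-- Decay of the Legendre coefficients of `ω`. -/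
theorem exists_abs_integral_mul_legendre_le {k m j : ℕ} {α μ : ℝ} (hα0 : 0 < α) (hα : α < k)
    (hj1 : (j : ℝ) < α + m - 1) (hj2 : α + m - 1 < j + 1) (hkj : k ≤ j + 2)
    (hμ1 : μ ≤ 2 * α + 1) (hμ2 : μ ≤ α + m - 1 / 2) :
    ∃ K : ℝ, 0 ≤ K ∧ ∀ n : ℕ, j + 2 ≤ n → ∀ (ω : ℝ → ℝ) (L : ℕ → ℝ), MemUL k m α ω L →
      |∫ x in (-1 : ℝ)..1, ω x * (legendre n).eval x| ≤
        K * (n : ℝ) ^ (-(μ + 1)) * UsemiL k m α ω L := by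
  have hpos : ∀ i : ℕ, 0 < α + i + 1 := fun i => by positivity
  choose K hK h using fun i : ℕ => exists_abs_fracInt_neg_one_legendre_le (hpos i)
  obtain ⟨K', hK', h'⟩ := fracBound_order_add_one hj1 hj2
  have hsum : 0 ≤ ∑ i ∈ Finset.range m, K i := Finset.sum_nonneg fun i _ => hK i
  refine ⟨∑ i ∈ Finset.range m, K i + K', by positivity, fun n hn ω L hω => ?_⟩
  have hn1 : (1 : ℝ) ≤ n := by exact_mod_cast (by omega : 1 ≤ n)
  have hnμ : 0 ≤ (n : ℝ) ^ (-(μ + 1)) := by positivity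
  have key := abs_integral_iteratedDeriv_mul_le (j := 0) (R := legendre n)
    (M := (∑ i ∈ Finset.range m, K i + K') * (n : ℝ) ^ (-(μ + 1))) hα hω (Nat.zero_le _)
    (by push_cast; linarith)
    (fun i hi hik => fracInt_neg_one_legendre_eq_zero hi (by omega)) ?_ ?_
  · simpa only [iteratedDeriv_zero] using key
  · intro i hi
    have hile : K i ≤ ∑ i ∈ Finset.range m, K i + K' :=
      (Finset.single_le_sum (fun i _ => hK i) (Finset.mem_range.2 hi)).trans (by linarith)
    rw [Nat.cast_zero, sub_zero]
    have hi0 : (0 : ℝ) ≤ i := i.cast_nonneg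
    exact (h i n).trans (mul_le_mul hile
      (rpow_neg_add_one_le_rpow_neg (by omega) (by linarith) (by linarith))
      (by positivity) (by positivity))
  · intro x hx
    rw [Nat.cast_zero, sub_zero, show α + m = α + m - 1 + 1 by ring]
    exact (h' n hn x hx).trans (mul_le_mul (by linarith)
      (Real.rpow_le_rpow_of_exponent_le hn1 (by linarith)) (by positivity) (by positivity))

/-- Decay of the pairing of `ω'` with `legendre n + legendre (n + 1)`. -/
theorem exists_abs_integral_deriv_mul_legendre_add_le {k m j : ℕ} {α μ : ℝ} (hk : 1 ≤ k)
    (hα0 : 0 < α) (hα : α < k)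
    (hj1 : (j : ℝ) < α + m - 1) (hj2 : α + m - 1 < j + 1) (hkj : k ≤ j + 2)
    (hμ1 : μ ≤ 2 * α + 1) (hμ2 : μ ≤ α + m - 1 / 2) :
    ∃ K : ℝ, 0 ≤ K ∧ ∀ n : ℕ, j + 1 ≤ n → ∀ (ω : ℝ → ℝ) (L : ℕ → ℝ), MemUL k m α ω L →
      |∫ x in (-1 : ℝ)..1, iteratedDeriv 1 ω x * (legendre n + legendre (n + 1)).eval x| ≤
        K * (n : ℝ) ^ (1 / 2 - μ) * UsemiL k m α ω L := by
  have hpos : ∀ i : ℕ, 0 < α + i := fun i => by positivity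
  choose K hK h using fun i : ℕ => exists_abs_fracInt_neg_one_legendre_add_le (hpos i)
  obtain ⟨K', hK', h'⟩ := fracBound_order hj1 hj2
  have hsum : 0 ≤ ∑ i ∈ Finset.range m, K i := Finset.sum_nonneg fun i _ => hK i
  refine ⟨∑ i ∈ Finset.range m, K i + 2 * K', by positivity, fun n hn ω L hω => ?_⟩
  have hn1 : (1 : ℝ) ≤ n := by exact_mod_cast (by omega : 1 ≤ n)
  have hnμ : 0 ≤ (n : ℝ) ^ (1 / 2 - μ) := by positivity
  refine abs_integral_iteratedDeriv_mul_le (j := 1) hα hω hk (by push_cast; linarith)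
    (fun i hi hik => ?_) ?_ ?_
  · rw [map_add, fracInt_neg_one_legendre_eq_zero hi (by omega),
      fracInt_neg_one_legendre_eq_zero hi (by omega), add_zero]
  · intro i hi
    have hile : K i ≤ ∑ i ∈ Finset.range m, K i + 2 * K' :=
      (Finset.single_le_sum (fun i _ => hK i) (Finset.mem_range.2 hi)).trans (by linarith)
    rw [Nat.cast_one, show α - 1 + i + 1 = α + i by ring, show 1 / 2 - μ = -(μ - 1 / 2) by ring]
    have hi0 : (0 : ℝ) ≤ i := i.cast_nonneg
    exact (h i n).trans (mul_le_mul hile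
      (rpow_neg_add_one_le_rpow_neg (by omega) (by linarith) (by linarith))
      (by positivity) (by positivity))
  · intro x hx
    rw [Nat.cast_one, show α - 1 + m = α + m - 1 by ring, map_add]
    have hγ : 0 ≤ α + m - 1 := le_trans j.cast_nonneg hj1.le
    have e1 : (n : ℝ) ^ (-(α + m - 1)) ≤ (n : ℝ) ^ (1 / 2 - μ) :=
      Real.rpow_le_rpow_of_exponent_le hn1 (by linarith)
    have e2 : ((n + 1 : ℕ) : ℝ) ^ (-(α + m - 1)) ≤ (n : ℝ) ^ (1 / 2 - μ) := by
      rw [Nat.cast_succ, show 1 / 2 - μ = -(μ - 1 / 2) by ring]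
      exact rpow_neg_add_one_le_rpow_neg (by omega) (by linarith) hγ
    have b1 := (h' n hn x hx).trans (mul_le_mul_of_nonneg_left e1 hK')
    have b2 := (h' (n + 1) (by omega) x hx).trans (mul_le_mul_of_nonneg_left e2 hK')
    refine (abs_add_le _ _).trans ((add_le_add b1 b2).trans ?_)
    have := mul_nonneg hsum hnμ
    linarith

/-- Bessel-type criterion: a bound on all finite Legendre energies bounds the `L²` norm. -/
theorem integral_sq_le_of_sum_legendre_le {e : ℝ → ℝ} (he : ContinuousOn e (Icc (-1) 1)) {B : ℝ}
    (hB : ∀ s : Finset ℕ, ∑ i ∈ s, (2 * (i : ℝ) + 1) / 2 *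
      (∫ x in (-1 : ℝ)..1, e x * (legendre i).eval x) ^ 2 ≤ B) :
    ∫ x in (-1 : ℝ)..1, e x ^ 2 ≤ B := by
  have h11 : (-1 : ℝ) ≤ 1 := by norm_num
  have hci : ∀ {f : ℝ → ℝ}, ContinuousOn f (Icc (-1) 1) → IntervalIntegrable f volume (-1) 1 :=
    fun hf => ContinuousOn.intervalIntegrable (by rwa [uIcc_of_le h11])
  refine le_of_forall_pos_le_add fun ε hε => ?_
  obtain ⟨q, hq⟩ := exists_polynomial_near_of_continuousOn (-1) 1 e he (Real.sqrt (ε / 2))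
    (Real.sqrt_pos.2 (by positivity))
  obtain ⟨s, c, hqs⟩ := exists_eq_sum_legendre q
  have hqc : ContinuousOn (fun x => q.eval x) (Icc (-1 : ℝ) 1) := q.continuous.continuousOn
  have h1 : ∫ x in (-1 : ℝ)..1, (e x - q.eval x) ^ 2 ≤ ε := by
    calc _ ≤ ∫ x in (-1 : ℝ)..1, ε / 2 := by
          refine intervalIntegral.integral_mono_on h11 (hci ((he.sub hqc).pow 2)) (by simp)
            fun x hx => ?_
          have := (hq x hx).le
          rw [abs_sub_comm] at this
          calc (e x - q.eval x) ^ 2 = |e x - q.eval x| ^ 2 := (sq_abs _).symm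
            _ ≤ Real.sqrt (ε / 2) ^ 2 := pow_le_pow_left₀ (abs_nonneg _) this 2
            _ = ε / 2 := Real.sq_sqrt (by positivity)
      _ = ε := by rw [intervalIntegral.integral_const, smul_eq_mul]; ring
  set a : ℕ → ℝ := fun i => ∫ x in (-1 : ℝ)..1, e x * (legendre i).eval x with ha
  have hpl : ∀ i, ContinuousOn (fun x => (legendre i).eval x) (Icc (-1 : ℝ) 1) :=
    fun i => (legendre i).continuous.continuousOn
  have hqe : ∀ x, q.eval x = ∑ i ∈ s, c i * (legendre i).eval x := by
    intro x; rw [hqs, eval_finsetSum]; simp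
  have heq : ∫ x in (-1 : ℝ)..1, e x * q.eval x = ∑ i ∈ s, c i * a i := by
    simp only [hqe, Finset.mul_sum]
    have hii : ∀ i, IntervalIntegrable (fun x => e x * (c i * (legendre i).eval x))
        volume (-1) 1 := fun i => hci (he.mul (continuousOn_const.mul (hpl i)))
    rw [intervalIntegral.integral_finsetSum fun i _ => hii i]
    refine Finset.sum_congr rfl fun i _ => ?_
    rw [ha, ← intervalIntegral.integral_const_mul]
    exact intervalIntegral.integral_congr fun x _ => by ring
  have hqq : ∫ x in (-1 : ℝ)..1, q.eval x ^ 2 = ∑ i ∈ s, c i ^ 2 * (2 / (2 * (i : ℝ) + 1)) := by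
    have hx : ∀ x, q.eval x ^ 2 =
        ∑ i ∈ s, ∑ l ∈ s, c i * c l * ((legendre i).eval x * (legendre l).eval x) := by
      intro x
      rw [hqe, sq, Finset.sum_mul_sum]
      exact Finset.sum_congr rfl fun i _ => Finset.sum_congr rfl fun l _ => by ring
    have hii : ∀ i l, IntervalIntegrable (fun x => c i * c l *
        ((legendre i).eval x * (legendre l).eval x)) volume (-1) 1 := fun i l =>
      hci (continuousOn_const.mul ((hpl i).mul (hpl l)))
    have hiis : ∀ i, IntervalIntegrable (fun x => ∑ l ∈ s, c i * c l *
        ((legendre i).eval x * (legendre l).eval x)) volume (-1) 1 := fun i =>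
      hci (continuousOn_finsetSum _ fun l _ => continuousOn_const.mul ((hpl i).mul (hpl l)))
    simp only [hx]
    rw [intervalIntegral.integral_finsetSum fun i _ => hiis i]
    refine Finset.sum_congr rfl fun i hi => ?_
    rw [intervalIntegral.integral_finsetSum fun l _ => hii i l, Finset.sum_eq_single i]
    · rw [intervalIntegral.integral_const_mul, ← integral_legendre_sq, ← sq]
      simp only [sq]
    · intro l _ hl
      rw [intervalIntegral.integral_const_mul, integral_legendre_mul_legendre hl.symm, mul_zero]
    · exact fun h => absurd hi h
  have hexp : ∫ x in (-1 : ℝ)..1, (e x - q.eval x) ^ 2 =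
      (∫ x in (-1 : ℝ)..1, e x ^ 2) - 2 * (∫ x in (-1 : ℝ)..1, e x * q.eval x) +
        ∫ x in (-1 : ℝ)..1, q.eval x ^ 2 := by
    have i1 : IntervalIntegrable (fun x => e x ^ 2) volume (-1) 1 := hci (he.pow 2)
    have i2 : IntervalIntegrable (fun x => 2 * (e x * q.eval x)) volume (-1) 1 :=
      hci (continuousOn_const.mul (he.mul hqc))
    have i3 : IntervalIntegrable (fun x => q.eval x ^ 2) volume (-1) 1 := hci (hqc.pow 2)
    rw [← intervalIntegral.integral_const_mul, ← intervalIntegral.integral_sub i1 i2,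
      ← intervalIntegral.integral_add (i1.sub i2) i3]
    exact intervalIntegral.integral_congr fun x _ => by ring
  have hsum : 2 * ∑ i ∈ s, c i * a i - ∑ i ∈ s, c i ^ 2 * (2 / (2 * (i : ℝ) + 1)) ≤
      ∑ i ∈ s, (2 * (i : ℝ) + 1) / 2 * a i ^ 2 := by
    rw [Finset.mul_sum, ← Finset.sum_sub_distrib]
    refine Finset.sum_le_sum fun i _ => ?_
    have hw : (0 : ℝ) < 2 * (i : ℝ) + 1 := by positivity
    have : (2 * (i : ℝ) + 1) / 2 * a i ^ 2 - (2 * (c i * a i) - c i ^ 2 * (2 / (2 * (i : ℝ) + 1))) =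
        (2 * (i : ℝ) + 1) / 2 * (a i - 2 / (2 * (i : ℝ) + 1) * c i) ^ 2 := by
      field_simp; ring
    have h0 : 0 ≤ (2 * (i : ℝ) + 1) / 2 * (a i - 2 / (2 * (i : ℝ) + 1) * c i) ^ 2 := by positivity
    linarith
  have := hB s
  linarith

theorem rpow_neg_add_one_le_sub_div {x ν : ℝ} (hx : 0 < x) (hν : 0 < ν) :
    (x + 1) ^ (-(ν + 1)) ≤ (x ^ (-ν) - (x + 1) ^ (-ν)) / ν := by
  have hx1 : 0 < x + 1 := by linarith
  have h1 : x / (x + 1) ≤ Real.exp (-(x + 1)⁻¹) := by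
    have := Real.add_one_le_exp (-(x + 1)⁻¹)
    refine le_trans (le_of_eq ?_) this
    field_simp
    ring
  have h2 : 1 + ν / (x + 1) ≤ (x / (x + 1)) ^ (-ν) := by
    calc 1 + ν / (x + 1) ≤ Real.exp (ν / (x + 1)) := by
          rw [add_comm]; exact Real.add_one_le_exp _
      _ = Real.exp (-(x + 1)⁻¹) ^ (-ν) := by
          rw [← Real.exp_mul]; congr 1; field_simp
      _ ≤ _ := Real.rpow_le_rpow_of_nonpos (by positivity) h1 (by linarith)
  rw [Real.div_rpow hx.le hx1.le, le_div_iff₀ (by positivity)] at h2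
  rw [le_div_iff₀ hν, neg_add, Real.rpow_add hx1, Real.rpow_neg_one]
  have : (1 + ν / (x + 1)) * (x + 1) ^ (-ν) =
      (x + 1) ^ (-ν) + (x + 1) ^ (-ν) * (x + 1)⁻¹ * ν := by ring
  linarith

theorem sum_Ioc_rpow_neg_le {p N : ℕ} {ν : ℝ} (hp : 1 ≤ p) (hN : p ≤ N) (hν : 0 < ν) :
    ∑ i ∈ Finset.Ioc p N, (i : ℝ) ^ (-(ν + 1)) ≤ ((p : ℝ) ^ (-ν) - (N : ℝ) ^ (-ν)) / ν := by
  induction N, hN using Nat.le_induction with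
  | base => simp
  | succ N hN ih =>
    rw [Finset.sum_Ioc_succ_top hN]
    have h := rpow_neg_add_one_le_sub_div
      (by exact_mod_cast (by omega : 0 < N) : (0 : ℝ) < N) hν
    push_cast
    calc _ ≤ ((p : ℝ) ^ (-ν) - (N : ℝ) ^ (-ν)) / ν +
          ((N : ℝ) ^ (-ν) - ((N : ℝ) + 1) ^ (-ν)) / ν := add_le_add ih h
      _ = _ := by ring

theorem sum_le_of_tail_le {t : ℕ → ℝ} {p : ℕ} {ν A D : ℝ} (ht : ∀ i, 0 ≤ t i) (hp : 1 ≤ p)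
    (hν : 0 < ν) (hD : 0 ≤ D) (h₀ : ∀ i < p, t i = 0) (hA : t p ≤ A)
    (h₁ : ∀ i, p < i → t i ≤ D * (i : ℝ) ^ (-(ν + 1))) (s : Finset ℕ) :
    ∑ i ∈ s, t i ≤ A + D * ((p : ℝ) ^ (-ν) / ν) := by
  set N := max p (s.sup id)
  have hpN : p ≤ N := le_max_left _ _
  calc ∑ i ∈ s, t i = ∑ i ∈ s with p ≤ i, t i := by
        rw [Finset.sum_filter_of_ne]
        intro i _ hi
        by_contra h
        exact hi (h₀ i (not_le.1 h))
    _ ≤ ∑ i ∈ Finset.Icc p N, t i := by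
        refine Finset.sum_le_sum_of_subset_of_nonneg (fun i hi => ?_) fun i _ _ => ht i
        rw [Finset.mem_filter] at hi
        exact Finset.mem_Icc.2 ⟨hi.2, (Finset.le_sup (f := id) hi.1).trans (le_max_right _ _)⟩
    _ = t p + ∑ i ∈ Finset.Ioc p N, t i := by
        rw [Finset.Icc_eq_cons_Ioc hpN, Finset.sum_cons]
    _ ≤ A + ∑ i ∈ Finset.Ioc p N, D * (i : ℝ) ^ (-(ν + 1)) :=
        add_le_add hA (Finset.sum_le_sum fun i hi => h₁ i (Finset.mem_Ioc.1 hi).1)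
    _ ≤ _ := by
        rw [← Finset.mul_sum]
        have h := sum_Ioc_rpow_neg_le hp hpN hν
        have h2 : ((p : ℝ) ^ (-ν) - (N : ℝ) ^ (-ν)) / ν ≤ (p : ℝ) ^ (-ν) / ν := by
          gcongr
          linarith [Real.rpow_nonneg N.cast_nonneg (-ν)]
        gcongr
        exact h.trans h2

/-- The first non-trivial Legendre coefficient of the Gauss–Radau projection error. -/
theorem integral_sub_mul_legendre_eq {p : ℕ} (hp : 1 ≤ p) {ω ω' : ℝ → ℝ}
    (hω : ContinuousOn ω (Icc (-1) 1))
    (hd : ∀ x ∈ Ioo (-1 : ℝ) 1, HasDerivAt ω (ω' x) x)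
    (hi : IntervalIntegrable ω' volume (-1) 1) {P : ℝ[X]} (hP : P.natDegree ≤ p)
    (horth : ∀ v : ℝ[X], v.natDegree < p →
      ∫ x in (-1 : ℝ)..1, (ω x - P.eval x) * v.eval x = 0)
    (h1 : P.eval 1 = ω 1) :
    (2 * (p : ℝ) + 1) * ∫ x in (-1 : ℝ)..1, (ω x - P.eval x) * (legendre p).eval x =
      -∫ x in (-1 : ℝ)..1, ω' x * (legendre p + legendre (p + 1)).eval x := by
  have h11 : (-1 : ℝ) ≤ 1 := by norm_num
  have hci : ∀ {f : ℝ → ℝ}, ContinuousOn f (Icc (-1) 1) → IntervalIntegrable f volume (-1) 1 :=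
    fun hf => ContinuousOn.intervalIntegrable (by rwa [uIcc_of_le h11])
  set Q := legendre p + legendre (p + 1) with hQ
  have he : ContinuousOn (fun x => ω x - P.eval x) (Icc (-1 : ℝ) 1) :=
    hω.sub P.continuous.continuousOn
  have hQm : Q.eval (-1) = 0 := by
    rw [hQ, eval_add, eval_neg_one_legendre, eval_neg_one_legendre, pow_succ]
    ring
  have i1 : IntervalIntegrable (fun x => ω' x * Q.eval x) volume (-1) 1 :=
    hi.mul_continuousOn Q.continuous.continuousOn
  have hcm : ∀ q r : ℝ[X], IntervalIntegrable (fun x => q.eval x * r.eval x) volume (-1) 1 :=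
    fun q r => (q.continuous.mul r.continuous).intervalIntegrable _ _
  have hce : ∀ r : ℝ[X],
      IntervalIntegrable (fun x => (ω x - P.eval x) * r.eval x) volume (-1) 1 :=
    fun r => hci (he.mul r.continuous.continuousOn)
  have hftc := intervalIntegral.integral_eq_sub_of_hasDerivAt_of_le h11
    (he.mul Q.continuous.continuousOn)
    (f' := fun x => ω' x * Q.eval x - (derivative P).eval x * Q.eval x +
      (ω x - P.eval x) * (derivative Q).eval x)
    (fun x hx => (((hd x hx).sub (P.hasDerivAt x)).mul (Q.hasDerivAt x)).congr_deriv
      (by simp only [Pi.sub_apply]; ring))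
    ((i1.sub (hcm _ _)).add (hce _))
  rw [intervalIntegral.integral_add (i1.sub (hcm _ _)) (hce _),
    intervalIntegral.integral_sub i1 (hcm _ _)] at hftc
  simp only [Pi.mul_apply, h1, hQm, sub_self, zero_mul, mul_zero] at hftc
  have hPQ : ∫ x in (-1 : ℝ)..1, (derivative P).eval x * Q.eval x = 0 := by
    have hdeg : (derivative P).natDegree < p :=
      (natDegree_derivative_le P).trans_lt (by omega)
    simp only [hQ, eval_add, mul_add]
    rw [intervalIntegral.integral_add (hcm _ _) (hcm _ _), integral_mul_legendre_eq_zero hdeg,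
      integral_mul_legendre_eq_zero (by omega), add_zero]
  have hQ' : ∫ x in (-1 : ℝ)..1, (ω x - P.eval x) * (derivative Q).eval x =
      (2 * (p : ℝ) + 1) * ∫ x in (-1 : ℝ)..1, (ω x - P.eval x) * (legendre p).eval x := by
    obtain ⟨q, rfl⟩ := Nat.exists_eq_add_of_le' hp
    have hdec : derivative Q = derivative (legendre (q + 1) + legendre q) +
        C (2 * (q : ℝ) + 3) * legendre (q + 1) := by
      rw [← derivative_legendre_add_two_sub, hQ, derivative_add, derivative_add]
      ring
    have hdeg : (derivative (legendre (q + 1) + legendre q)).natDegree < q + 1 := by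
      refine (natDegree_derivative_le _).trans_lt ?_
      have := natDegree_add_le_of_degree_le (natDegree_legendre_le (q + 1))
        ((natDegree_legendre_le q).trans q.le_succ)
      omega
    have hx : ∀ x, (ω x - P.eval x) * (derivative Q).eval x =
        (ω x - P.eval x) * (derivative (legendre (q + 1) + legendre q)).eval x +
          (2 * (q : ℝ) + 3) * ((ω x - P.eval x) * (legendre (q + 1)).eval x) := by
      intro x
      rw [hdec, eval_add, eval_mul, eval_C]
      ring
    simp only [hx]
    rw [intervalIntegral.integral_add (hce _) ((hce _).const_mul _), horth _ hdeg,
      intervalIntegral.integral_const_mul]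
    push_cast
    ring
  rw [← hQ']
  linarith

theorem integral_sub_sq_le {p : ℕ} {μ K₀ K₁ U : ℝ} (hp : 1 ≤ p) (hμ : 0 < μ)
    {ω ω' : ℝ → ℝ} (hω : ContinuousOn ω (Icc (-1) 1))
    (hd : ∀ x ∈ Ioo (-1 : ℝ) 1, HasDerivAt ω (ω' x) x)
    (hi : IntervalIntegrable ω' volume (-1) 1) {P : ℝ[X]} (hP : P.natDegree ≤ p)
    (horth : ∀ v : ℝ[X], v.natDegree < p →
      ∫ x in (-1 : ℝ)..1, (ω x - P.eval x) * v.eval x = 0)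
    (h1 : P.eval 1 = ω 1)
    (hK₀ : ∀ n : ℕ, p < n → |∫ x in (-1 : ℝ)..1, ω x * (legendre n).eval x| ≤
      K₀ * (n : ℝ) ^ (-(μ + 1)) * U)
    (hK₁ : |∫ x in (-1 : ℝ)..1, ω' x * (legendre p + legendre (p + 1)).eval x| ≤
      K₁ * (p : ℝ) ^ (1 / 2 - μ) * U) :
    ∫ x in (-1 : ℝ)..1, (ω x - P.eval x) ^ 2 ≤
      (K₁ ^ 2 + K₀ ^ 2 / μ) * ((p : ℝ) ^ (-μ) * U) ^ 2 := by
  have h11 : (-1 : ℝ) ≤ 1 := by norm_num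
  have hci : ∀ {f : ℝ → ℝ}, ContinuousOn f (Icc (-1) 1) → IntervalIntegrable f volume (-1) 1 :=
    fun hf => ContinuousOn.intervalIntegrable (by rwa [uIcc_of_le h11])
  have he : ContinuousOn (fun x => ω x - P.eval x) (Icc (-1 : ℝ) 1) :=
    hω.sub P.continuous.continuousOn
  have hpR : (1 : ℝ) ≤ p := by exact_mod_cast hp
  have hp0 : (0 : ℝ) < p := by linarith
  have hsq : ∀ {x : ℝ}, 0 < x → ∀ r : ℝ, (x ^ r) ^ 2 = x ^ (r * 2) := fun hx r => by
    rw [← Real.rpow_natCast, ← Real.rpow_mul hx.le]; norm_num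
  refine (integral_sq_le_of_sum_legendre_le he (B := K₁ ^ 2 * ((p : ℝ) ^ (-μ) * U) ^ 2 +
    2 * K₀ ^ 2 * U ^ 2 * ((p : ℝ) ^ (-(2 * μ)) / (2 * μ))) fun s => ?_).trans (le_of_eq ?_)
  · refine sum_le_of_tail_le (fun i => by positivity) hp (by positivity) (by positivity)
      (fun i hip => ?_) ?_ (fun i hip => ?_) s
    · rw [horth _ ((natDegree_legendre_le i).trans_lt hip)]
      ring
    · have hcoef := integral_sub_mul_legendre_eq hp hω hd hi hP horth h1
      set a := ∫ x in (-1 : ℝ)..1, (ω x - P.eval x) * (legendre p).eval x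
      have h2 : ((2 * (p : ℝ) + 1) * a) ^ 2 ≤ (K₁ * (p : ℝ) ^ (1 / 2 - μ) * U) ^ 2 := by
        rw [hcoef, neg_sq, ← sq_abs]
        exact pow_le_pow_left₀ (abs_nonneg _) hK₁ 2
      have h3 : ((p : ℝ) ^ (1 / 2 - μ)) ^ 2 = p * ((p : ℝ) ^ (-μ)) ^ 2 := by
        rw [hsq hp0, hsq hp0]
        nth_rewrite 2 [← Real.rpow_one (p : ℝ)]
        rw [← Real.rpow_add hp0]
        ring_nf
      rw [mul_pow, mul_pow, mul_pow, h3] at h2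
      have h4 : 0 ≤ (K₁ * ((p : ℝ) ^ (-μ) * U)) ^ 2 := sq_nonneg _
      have h5 : (2 * (p : ℝ) + 1) * ((2 * (p : ℝ) + 1) / 2 * a ^ 2) ≤
          (2 * (p : ℝ) + 1) * (K₁ ^ 2 * ((p : ℝ) ^ (-μ) * U) ^ 2) := by
        nlinarith
      exact le_of_mul_le_mul_left h5 (by positivity)
    · have hi0 : (0 : ℝ) < i := by exact_mod_cast (by omega : 0 < i)
      have hi1 : (1 : ℝ) ≤ i := by exact_mod_cast (by omega : 1 ≤ i)
      have hcoef : ∫ x in (-1 : ℝ)..1, (ω x - P.eval x) * (legendre i).eval x =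
          ∫ x in (-1 : ℝ)..1, ω x * (legendre i).eval x := by
        have i1 : IntervalIntegrable (fun x => ω x * (legendre i).eval x) volume (-1) 1 :=
          hci (hω.mul (legendre i).continuous.continuousOn)
        have i2 : IntervalIntegrable (fun x => P.eval x * (legendre i).eval x) volume (-1) 1 :=
          (P.continuous.mul (legendre i).continuous).intervalIntegrable _ _
        simp only [sub_mul]
        rw [intervalIntegral.integral_sub i1 i2,
          integral_mul_legendre_eq_zero (hP.trans_lt hip), sub_zero]
      rw [hcoef, ← sq_abs]
      have h2 := pow_le_pow_left₀ (abs_nonneg _) (hK₀ i hip) 2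
      have h3 : ((i : ℝ) ^ (-(μ + 1))) ^ 2 * i = (i : ℝ) ^ (-(2 * μ + 1)) := by
        rw [hsq hi0]
        nth_rewrite 2 [← Real.rpow_one (i : ℝ)]
        rw [← Real.rpow_add hi0]
        ring_nf
      calc _ ≤ (2 * (i : ℝ)) * (K₀ * (i : ℝ) ^ (-(μ + 1)) * U) ^ 2 := by
            gcongr
            linarith
        _ = 2 * K₀ ^ 2 * U ^ 2 * (((i : ℝ) ^ (-(μ + 1))) ^ 2 * i) := by ring
        _ = _ := by rw [h3]
  · rw [mul_pow, hsq hp0, show -μ * 2 = -(2 * μ) by ring]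
    field_simp

end RadauCaputo

open RadauCaputo

/-- optimal `L²` estimate for the Gauss–Radau projection `Π_p^−`
of `ω ∈ 𝒰^{α,m}_{−1+}((−1,1))`. -/
theorem stmt_8 (k m : ℕ) (hk : 1 ≤ k) (hm : 1 ≤ m) (α : ℝ)
    (hα1 : (k : ℝ) - 1 < α) (hα2 : α < (k : ℝ)) (hαint : ∀ j : ℤ, α ≠ (j : ℝ))
    (hαm : 1 / 2 < α + (m : ℝ)) :
    ∃ C > (0 : ℝ), ∀ p : ℕ, α + (m : ℝ) < (p : ℝ) + 1 →
      ∀ (ω : ℝ → ℝ) (L : ℕ → ℝ), MemUL k m α ω L →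
        ∀ P : Polynomial ℝ, P.natDegree ≤ p →
          (∀ v : Polynomial ℝ, v.natDegree < p →
              ∫ x in (-1 : ℝ)..1, (P.eval x - ω x) * v.eval x = 0) →
          P.eval 1 = ω 1 →
          Real.sqrt (∫ x in (-1 : ℝ)..1, (ω x - P.eval x) ^ 2) ≤
            C * (p : ℝ) ^ (-(min (2 * α + 1) (α + (m : ℝ) - 1 / 2))) *
              UsemiL k m α ω L := by
  have hk' : (1 : ℝ) ≤ k := by exact_mod_cast hk
  have hm' : (1 : ℝ) ≤ m := by exact_mod_cast hm
  have hα0 : 0 < α := by linarith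
  set μ := min (2 * α + 1) (α + (m : ℝ) - 1 / 2)
  have hμ : 0 < μ := lt_min (by linarith) (by linarith)
  obtain ⟨j, hj1, hj2⟩ : ∃ j : ℕ, (j : ℝ) < α + m - 1 ∧ α + m - 1 < j + 1 := by
    refine ⟨⌊α + m - 1⌋₊, lt_of_le_of_ne (Nat.floor_le (by linarith)) fun h => ?_,
      Nat.lt_floor_add_one _⟩
    refine hαint (⌊α + m - 1⌋₊ - m + 1) ?_
    push_cast
    linarith
  have hkj : k ≤ j + 2 := by
    have : (k : ℝ) < ((j + 2 : ℕ) : ℝ) := by push_cast; linarith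
    exact_mod_cast this.le
  obtain ⟨K₀, -, h₀⟩ := exists_abs_integral_mul_legendre_le hα0 hα2 hj1 hj2 hkj
    (min_le_left _ _ : μ ≤ _) (min_le_right _ _)
  obtain ⟨K₁, -, h₁⟩ := exists_abs_integral_deriv_mul_legendre_add_le hk hα0 hα2 hj1 hj2 hkj
    (min_le_left _ _ : μ ≤ _) (min_le_right _ _)
  set c := K₁ ^ 2 + K₀ ^ 2 / μ
  have hc : 0 ≤ c := by positivity
  refine ⟨1 + c, by positivity, fun p hp ω L hω P hP horth h1 => ?_⟩
  have hjp : j + 1 ≤ p := by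
    have : (j : ℝ) < p := by linarith
    exact_mod_cast this
  have hU := usemiL_nonneg k m α ω L
  have hd : ∀ x ∈ Ioo (-1 : ℝ) 1, HasDerivAt ω (iteratedDeriv 1 ω x) x := by
    simpa only [iteratedDeriv_zero] using hω.2.1 0 (by omega)
  have horth' : ∀ v : Polynomial ℝ, v.natDegree < p →
      ∫ x in (-1 : ℝ)..1, (ω x - P.eval x) * v.eval x = 0 := fun v hv => by
    rw [← neg_eq_zero, ← intervalIntegral.integral_neg, ← horth v hv]
    exact intervalIntegral.integral_congr fun x _ => by ring
  have key := integral_sub_sq_le (by omega) hμ hω.1 hd (hω.2.2.1 1 hk) hP horth' h1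
    (fun n hn => h₀ n (by omega) ω L hω) (h₁ p hjp ω L hω)
  refine Real.sqrt_le_iff.2 ⟨by positivity, key.trans ?_⟩
  rw [mul_assoc, mul_pow (1 + c)]
  gcongr
  nlinarith
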